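/- Let D be a strongly connected balanced bipartite digraph of order 2a ≥ 6 that is not a directed cycle, and suppose d(x)+d(y) ≥ 3a for every pair of distinct vertices x, y with a common in-neighbor or a common out-neighbor. Then D contains cycles of every even length 2, 4, ..., 2a. -/

import Mathlib

open Finset

section Defs

variable {V : Type*}

/-- `D` contains a directed cycle of length `k` (`k ≥ 2`): an injective map from
`ZMod k` such that consecutive vertices are joined by arcs. -/
def HasCycle (A : V → V → Prop) (k : ℕ) : Prop :=
  2 ≤ k ∧ ∃ f : ZMod k → V, Function.Injective f ∧ ∀ i, A (f i) (f (i + 1))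

/-- A digraph is strongly connected if every vertex is reachable from every other. -/
def StrongConn (A : V → V → Prop) : Prop := ∀ u v : V, Relation.ReflTransGen A u v

def outDeg [Fintype V] (A : V → V → Prop) [DecidableRel A] (u : V) : ℕ :=
  (Finset.univ.filter fun v => A u v).card

def inDeg [Fintype V] (A : V → V → Prop) [DecidableRel A] (u : V) : ℕ :=
  (Finset.univ.filter fun v => A v u).card

/-- total degree -/
def deg [Fintype V] (A : V → V → Prop) [DecidableRel A] (u : V) : ℕ :=
  outDeg A u + inDeg A u

/-- `D` is bipartite with partite sets `X`, `Y`: they partition the vertex set and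
every arc goes between the two sets. -/
def BipartiteWith [Fintype V] [DecidableEq V] (A : V → V → Prop) (X Y : Finset V) : Prop :=
  Disjoint X Y ∧ X ∪ Y = Finset.univ ∧
    ∀ u v, A u v → (u ∈ X ∧ v ∈ Y) ∨ (u ∈ Y ∧ v ∈ X)

/-- Bipartite digraph with explicitly indexed partite sets
`X = {x 0, …, x (a-1)}`, `Y = {y 0, …, y (a-1)}`. -/
def IndexedBipartite {a : ℕ} (A : V → V → Prop) (x y : Fin a → V) : Prop :=
  Function.Injective x ∧ Function.Injective y ∧ (∀ i j, x i ≠ y j) ∧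
  (∀ v : V, (∃ i, v = x i) ∨ (∃ i, v = y i)) ∧
  ∀ u v, A u v → (∃ i j, u = x i ∧ v = y j) ∨ (∃ i j, u = y i ∧ v = x j)

/-- The contracted digraph `D*[M]` of the matching `y i → x i`:
arc `v_l → v_j` (`l ≠ j`) iff `x l → y j` in `D`. -/
def Dstar {a : ℕ} (A : V → V → Prop) (x y : Fin a → V) : Fin a → Fin a → Prop :=
  fun l j => l ≠ j ∧ A (x l) (y j)

instance {a : ℕ} (A : V → V → Prop) [DecidableRel A] (x y : Fin a → V) :
    DecidableRel (Dstar A x y) := fun l j => by unfold Dstar; infer_instance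

/-- The size of a perfect matching `y i → x (π i)` from `Y` to `X`:
the number of matched pairs with no arc back from `X` to `Y`. -/
def matchSize {a : ℕ} (A : V → V → Prop) [DecidableRel A] (x y : Fin a → V)
    (π : Equiv.Perm (Fin a)) : ℕ :=
  (Finset.univ.filter fun i => ¬ A (x (π i)) (y i)).card

/-- `y i → x i` is a perfect matching from `Y` to `X` of maximum size among all
perfect matchings from `Y` to `X`. -/
def IsMaxMatching {a : ℕ} (A : V → V → Prop) [DecidableRel A] (x y : Fin a → V) : Prop :=
  (∀ i, A (y i) (x i)) ∧
  ∀ π : Equiv.Perm (Fin a), (∀ i, A (y i) (x (π i))) →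
    matchSize A x y π ≤ matchSize A x y 1

/-- `D` is a directed cycle: its arcs are exactly those of a cyclic ordering of all vertices. -/
def IsDirectedCycle [Fintype V] (A : V → V → Prop) : Prop :=
  ∃ e : V ≃ ZMod (Fintype.card V), ∀ u v, A u v ↔ e v = e u + 1

end Defs

section Cycles

variable {V : Type*} {A : V → V → Prop}

/-- A sequence that enumerates the vertices of a directed cycle of length `n`. -/
structure CycleSeq (A : V → V → Prop) (n : ℕ) (g : ℕ → V) : Prop where
  inj : ∀ i < n, ∀ j < n, g i = g j → i = j
  arc : ∀ i, i + 1 < n → A (g i) (g (i + 1))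
  close : A (g (n - 1)) (g 0)

theorem CycleSeq.exists_zmod {n : ℕ} {g : ℕ → V} (h : CycleSeq A n g) (hn : 2 ≤ n) :
    ∃ f : ZMod n → V, Function.Injective f ∧ (∀ i, A (f i) (f (i + 1))) ∧
      ∀ v, (∃ i, f i = v) ↔ ∃ j < n, g j = v := by
  have : NeZero n := ⟨by omega⟩
  refine ⟨fun z => g z.val, ?_, ?_, ?_⟩
  · intro x y hxy
    exact ZMod.val_injective n (h.inj _ (ZMod.val_lt x) _ (ZMod.val_lt y) hxy)
  · intro i
    have hi := ZMod.val_lt i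
    simp only [ZMod.val_add, ZMod.val_one'' (show n ≠ 1 by omega)]
    by_cases hlt : i.val + 1 < n
    · rw [Nat.mod_eq_of_lt hlt]
      exact h.arc _ hlt
    · have heq : i.val + 1 = n := by omega
      rw [heq, Nat.mod_self, show i.val = n - 1 by omega]
      exact h.close
  · intro v
    constructor
    · rintro ⟨i, rfl⟩
      exact ⟨i.val, ZMod.val_lt i, rfl⟩
    · rintro ⟨j, hj, rfl⟩
      exact ⟨(j : ZMod n), by simp [ZMod.val_natCast, Nat.mod_eq_of_lt hj]⟩

theorem CycleSeq.hasCycle {n : ℕ} {g : ℕ → V} (h : CycleSeq A n g) (hn : 2 ≤ n) :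
    HasCycle A n := by
  obtain ⟨f, hf, hA, -⟩ := h.exists_zmod hn
  exact ⟨hn, f, hf, hA⟩

theorem zmod_natCast_inj {n i j : ℕ} (hi : i < n) (hj : j < n)
    (h : (i : ZMod n) = (j : ZMod n)) : i = j := by
  have := (ZMod.natCast_eq_natCast_iff' i j n).1 h
  rwa [Nat.mod_eq_of_lt hi, Nat.mod_eq_of_lt hj] at this

/-- A path outside a cycle whose ends attach to an arc of the cycle can be inserted there. -/
theorem exists_cycle_insert {n l : ℕ} (hn : 2 ≤ n) (hl : 0 < l) {f : ZMod n → V} {q : ℕ → V}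
    (hf : Function.Injective f) (hA : ∀ i, A (f i) (f (i + 1)))
    (hq : ∀ i < l, ∀ j < l, q i = q j → i = j) (hqA : ∀ i, i + 1 < l → A (q i) (q (i + 1)))
    (hdisj : ∀ i, ∀ j < l, f i ≠ q j) (t : ZMod n)
    (hin : A (f t) (q 0)) (hout : A (q (l - 1)) (f (t + 1))) :
    ∃ f' : ZMod (n + l) → V, Function.Injective f' ∧ (∀ i, A (f' i) (f' (i + 1))) ∧
      ∀ v, (∃ i, f' i = v) ↔ (∃ i, f i = v) ∨ ∃ j < l, q j = v := by
  have : NeZero n := ⟨by omega⟩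
  let g : ℕ → V := fun i => if i < n then f (t + 1 + i) else q (i - n)
  have g1 : ∀ i, i < n → g i = f (t + 1 + i) := fun i hi => if_pos hi
  have g2 : ∀ i, ¬ i < n → g i = q (i - n) := fun i hi => if_neg hi
  have hg : CycleSeq A (n + l) g := by
    refine ⟨?_, ?_, ?_⟩
    · intro i hi j hj hij
      by_cases h1 : i < n <;> by_cases h2 : j < n
      · rw [g1 i h1, g1 j h2] at hij
        exact zmod_natCast_inj h1 h2 (add_left_cancel (hf hij))
      · rw [g1 i h1, g2 j h2] at hij
        exact absurd hij (hdisj _ _ (by omega))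
      · rw [g2 i h1, g1 j h2] at hij
        exact absurd hij.symm (hdisj _ _ (by omega))
      · rw [g2 i h1, g2 j h2] at hij
        have := hq _ (by omega) _ (by omega) hij
        omega
    · intro i hi
      by_cases h1 : i + 1 < n
      · rw [g1 i (by omega), g1 _ h1]
        have := hA (t + 1 + i)
        simpa [add_assoc] using this
      · by_cases h2 : i < n
        · rw [g1 i h2, g2 _ h1, show i + 1 - n = 0 by omega]
          have hi1 : i + 1 = n := by omega
          have : (t + 1 + (i : ZMod n)) = t := by
            have h3 : ((i + 1 : ℕ) : ZMod n) = 0 := by rw [hi1]; simp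
            push_cast at h3
            rw [add_assoc, add_comm 1, h3, add_zero]
          rwa [this]
        · rw [g2 i h2, g2 _ h1, show i + 1 - n = i - n + 1 by omega]
          exact hqA _ (by omega)
    · rw [g2 _ (by omega), g1 0 (by omega), show n + l - 1 - n = l - 1 by omega]
      simpa using hout
  obtain ⟨f', h1, h2, h3⟩ := hg.exists_zmod (by omega)
  refine ⟨f', h1, h2, fun v => (h3 v).trans ?_⟩
  constructor
  · rintro ⟨j, hj, rfl⟩
    by_cases h : j < n
    · exact Or.inl ⟨_, (g1 j h).symm⟩
    · exact Or.inr ⟨j - n, by omega, (g2 j h).symm⟩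
  · rintro (⟨i, rfl⟩ | ⟨j, hj, rfl⟩)
    · refine ⟨(i - (t + 1)).val, (ZMod.val_lt _).trans_le (by omega), ?_⟩
      rw [g1 _ (ZMod.val_lt _), ZMod.natCast_zmod_val]
      congr 1
      ring
    · exact ⟨n + j, by omega, by rw [g2 _ (by omega)]; congr 1; omega⟩

/-- There is a cycle of length `n` all of whose vertices avoid `P`. -/
def HasCycleAvoiding (A : V → V → Prop) (n : ℕ) (P : V → Prop) : Prop :=
  ∃ f : ZMod n → V, Function.Injective f ∧ (∀ i, A (f i) (f (i + 1))) ∧ ∀ i, ¬ P (f i)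

theorem HasCycleAvoiding.hasCycle {n : ℕ} {P : V → Prop} (h : HasCycleAvoiding A n P)
    (hn : 2 ≤ n) : HasCycle A n := by
  obtain ⟨f, hf, hA, -⟩ := h
  exact ⟨hn, f, hf, hA⟩

theorem hasCycleAvoiding_insert {n l : ℕ} (hn : 2 ≤ n) (hl : 0 < l) {f : ZMod n → V}
    {q : ℕ → V} (hf : Function.Injective f) (hA : ∀ i, A (f i) (f (i + 1)))
    (hq : ∀ i < l, ∀ j < l, q i = q j → i = j) (hqA : ∀ i, i + 1 < l → A (q i) (q (i + 1)))
    (hdisj : ∀ i, ∀ j < l, f i ≠ q j) {P : V → Prop} (hfP : ∀ i, ¬ P (f i))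
    (hqP : ∀ j < l, ¬ P (q j)) {t : ZMod n} (ht : A (f t) (q 0) ∧ A (q (l - 1)) (f (t + 1))) :
    HasCycleAvoiding A (n + l) P := by
  obtain ⟨f', hf', hA', hr⟩ := exists_cycle_insert hn hl hf hA hq hqA hdisj t ht.1 ht.2
  refine ⟨f', hf', hA', fun i hi => ?_⟩
  rcases (hr (f' i)).1 ⟨i, rfl⟩ with ⟨j, hj⟩ | ⟨j, hj, hj'⟩
  · exact hfP j (by rwa [hj])
  · exact hqP j hj (by rwa [hj'])

theorem exists_out (hs : StrongConn A) {u v : V} (huv : u ≠ v) : ∃ w, A u w := by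
  rcases Relation.ReflTransGen.cases_head (hs u v) with h | ⟨w, h, -⟩
  · exact absurd h huv
  · exact ⟨w, h⟩

theorem exists_in (hs : StrongConn A) {u v : V} (huv : u ≠ v) : ∃ w, A w v := by
  rcases Relation.ReflTransGen.cases_tail (hs u v) with h | ⟨w, -, h⟩
  · exact absurd h huv.symm
  · exact ⟨w, h⟩

/-- A set of vertices of a strong digraph that no arc leaves is closed under reachability. -/
theorem StrongConn.mem_of_closed (hs : StrongConn A) {P : V → Prop}
    (hP : ∀ u v, P u → A u v → P v) {u : V} (hu : P u) (v : V) : P v := by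
  induction hs u v with
  | refl => exact hu
  | tail _ h ih => exact hP _ _ ih h

/-- Two vertices share an in-neighbour or share an out-neighbour. -/
def ShareNeighbor (A : V → V → Prop) (u v : V) : Prop :=
  (∃ z, A z u ∧ A z v) ∨ ∃ z, A u z ∧ A v z

end Cycles

section CycleFactors

variable {V : Type*} [Fintype V] [DecidableEq V] {A : V → V → Prop} {σ : Equiv.Perm V}

theorem sameCycle_mul_swap {x y : V} (hxy : ¬ σ.SameCycle x y) {z : V} (hz : σ.SameCycle y z) :
    (σ * Equiv.swap x y).SameCycle x z := by
  have key : ∀ n : ℕ, (σ * Equiv.swap x y).SameCycle x ((σ ^ (n + 1)) y) := by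
    intro n
    induction n with
    | zero =>
      rw [show (σ ^ (0 + 1)) y = (σ * Equiv.swap x y) x by simp]
      exact Equiv.Perm.sameCycle_apply_right.2 (Equiv.Perm.SameCycle.refl _ _)
    | succ n ih =>
      have hs : (σ ^ (n + 1 + 1)) y = σ ((σ ^ (n + 1)) y) := by
        rw [pow_succ', Equiv.Perm.mul_apply]
      rw [hs]
      by_cases h : (σ ^ (n + 1)) y = y
      · rw [h, show σ y = (σ * Equiv.swap x y) x by simp]
        exact Equiv.Perm.sameCycle_apply_right.2 (Equiv.Perm.SameCycle.refl _ _)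
      · have hx : (σ ^ (n + 1)) y ≠ x := by
          intro h'
          exact hxy (Equiv.Perm.SameCycle.symm ⟨(n + 1 : ℕ), by rw [zpow_natCast, h']⟩)
        rw [show σ ((σ ^ (n + 1)) y) = (σ * Equiv.swap x y) ((σ ^ (n + 1)) y) by
          rw [Equiv.Perm.mul_apply, Equiv.swap_apply_of_ne_of_ne hx h]]
        exact Equiv.Perm.sameCycle_apply_right.2 ih
  obtain ⟨i, hi, -, rfl⟩ := hz.exists_pow_eq''
  obtain ⟨n, rfl⟩ : ∃ n, i = n + 1 := ⟨i - 1, by omega⟩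
  exact key n

theorem SameCycle.mul_swap {x y : V} (hxy : ¬ σ.SameCycle x y) {u z : V}
    (hz : σ.SameCycle u z) : (σ * Equiv.swap x y).SameCycle u z := by
  by_cases hy : σ.SameCycle y u
  · exact (sameCycle_mul_swap hxy hy).symm.trans (sameCycle_mul_swap hxy (hy.trans hz))
  by_cases hx : σ.SameCycle x u
  · have hyx : ¬ σ.SameCycle y x := fun h => hxy h.symm
    rw [Equiv.swap_comm]
    exact (sameCycle_mul_swap hyx hx).symm.trans (sameCycle_mul_swap hyx (hx.trans hz))
  have key : ∀ n : ℕ, (σ * Equiv.swap x y).SameCycle u ((σ ^ n) u) := by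
    intro n
    induction n with
    | zero => simpa using Equiv.Perm.SameCycle.refl _ u
    | succ n ih =>
      have hs : (σ ^ (n + 1)) u = (σ * Equiv.swap x y) ((σ ^ n) u) := by
        rw [pow_succ', Equiv.Perm.mul_apply, Equiv.Perm.mul_apply, Equiv.swap_apply_of_ne_of_ne]
        · intro h
          exact hx (Equiv.Perm.SameCycle.symm ⟨n, by rw [zpow_natCast, h]⟩)
        · intro h
          exact hy (Equiv.Perm.SameCycle.symm ⟨n, by rw [zpow_natCast, h]⟩)
      rw [hs]
      exact Equiv.Perm.sameCycle_apply_right.2 ih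
  obtain ⟨i, -, -, rfl⟩ := hz.exists_pow_eq''
  exact key i

open Classical in
/-- The number of ordered pairs of elements that lie on a common cycle of `σ`. -/
noncomputable def cyclePairs (σ : Equiv.Perm V) : ℕ :=
  (univ.filter fun p : V × V => σ.SameCycle p.1 p.2).card

theorem cyclePairs_lt {x y : V} (hxy : ¬ σ.SameCycle x y) :
    cyclePairs σ < cyclePairs (σ * Equiv.swap x y) := by
  classical
  unfold cyclePairs
  apply Finset.card_lt_card
  refine ⟨fun p hp => ?_, fun h => ?_⟩
  · simp only [mem_filter, mem_univ, true_and] at hp ⊢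
    exact SameCycle.mul_swap hxy hp
  · have := @h (x, y) (by simpa using sameCycle_mul_swap hxy (Equiv.Perm.SameCycle.refl σ y))
    exact hxy (by simpa using this)

theorem cyclePairs_conj (σ τ : Equiv.Perm V) : cyclePairs (τ * σ * τ⁻¹) = cyclePairs σ := by
  classical
  unfold cyclePairs
  refine Finset.card_equiv ((τ⁻¹).prodCongr τ⁻¹) ?_
  rintro ⟨x, y⟩
  simp [Equiv.Perm.sameCycle_conj]

/-- A spanning collection of disjoint cycles of `A`, encoded as a permutation, which maximizes
the number of pairs of vertices on a common cycle. -/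
structure MaxFactor (A : V → V → Prop) (σ : Equiv.Perm V) : Prop where
  arc : ∀ v, A v (σ v)
  max : ∀ τ : Equiv.Perm V, (∀ v, A v (τ v)) → cyclePairs τ ≤ cyclePairs σ

theorem exists_maxFactor (h : ∃ σ : Equiv.Perm V, ∀ v, A v (σ v)) :
    ∃ σ : Equiv.Perm V, MaxFactor A σ := by
  obtain ⟨σ, h1, h2⟩ := Set.exists_max_image {σ : Equiv.Perm V | ∀ v, A v (σ v)} cyclePairs
    (Set.toFinite _) h
  exact ⟨σ, h1, h2⟩

theorem MaxFactor.not_merge (hσ : MaxFactor A σ) {x y : V} (hxy : ¬ σ.SameCycle x y) :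
    ¬ (A x (σ y) ∧ A y (σ x)) := by
  rintro ⟨h1, h2⟩
  refine absurd (hσ.max (σ * Equiv.swap x y) fun v => ?_) (not_le.2 (cyclePairs_lt hxy))
  rw [Equiv.Perm.mul_apply]
  by_cases hx : v = x
  · rw [hx, Equiv.swap_apply_left]; exact h1
  by_cases hy : v = y
  · rw [hy, Equiv.swap_apply_right]; exact h2
  rw [Equiv.swap_apply_of_ne_of_ne hx hy]
  exact hσ.arc v

end CycleFactors

section Degrees

variable {V : Type*} [Fintype V] {A : V → V → Prop} {a : ℕ} {c : V → Bool}

/-- `c` is a proper 2-colouring of `A` with both colour classes of size `a`. -/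
structure BalancedColoring (A : V → V → Prop) (a : ℕ) (c : V → Bool) : Prop where
  arc : ∀ u v, A u v → c v = !c u
  card : ∀ b, (univ.filter fun v => c v = b).card = a

theorem BalancedColoring.arc' (hc : BalancedColoring A a c) {u v : V} (h : A u v) :
    c u = !c v := by
  simp [hc.arc u v h]

theorem BalancedColoring.card_le (hc : BalancedColoring A a c) {s : Finset V} {b : Bool}
    (h : ∀ v ∈ s, c v = b) : s.card ≤ a := by
  rw [← hc.card b]
  exact card_le_card fun v hv => by simpa using h v hv

theorem BalancedColoring.card_lt (hc : BalancedColoring A a c) {s : Finset V} {b : Bool}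
    (h : ∀ v ∈ s, c v = b) {w : V} (hw : c w = b) (hws : w ∉ s) : s.card < a := by
  rw [← hc.card b]
  exact card_lt_card ⟨fun v hv => by simpa using h v hv, fun h' => hws (h' (by simpa using hw))⟩

theorem BalancedColoring.exists_ne (hc : BalancedColoring A a c) (ha : 2 ≤ a) (u : V) :
    ∃ v, v ≠ u ∧ c v = c u := by
  have h := hc.card (c u)
  obtain ⟨v, hv, hne⟩ := Finset.exists_mem_ne (show 1 < (univ.filter fun v => c v = c u).card by omega) u
  exact ⟨v, hne, by simpa using hv⟩

theorem BalancedColoring.card_univ (hc : BalancedColoring A a c) : Fintype.card V = 2 * a := by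
  have h := card_filter_add_card_filter_not (s := (univ : Finset V)) (fun v => c v = true)
  simp only [Bool.not_eq_true] at h
  rw [hc.card, hc.card, Finset.card_univ] at h
  omega

theorem BalancedColoring.card_add_card_not (hc : BalancedColoring A a c) {b : Bool}
    {p : V → Prop} [DecidablePred p] (hp : ∀ v, p v → c v = b) :
    (univ.filter p).card + (univ.filter fun v => c v = b ∧ ¬ p v).card = a := by
  classical
  rw [← hc.card b, ← card_union_of_disjoint]
  · congr 1
    ext v
    have := hp v
    simp only [mem_union, mem_filter, mem_univ, true_and]
    tauto
  · rw [disjoint_left]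
    intro v h h'
    simp only [mem_filter, mem_univ, true_and] at h h'
    exact h'.2 h

theorem BalancedColoring.exists_ne_ne (hc : BalancedColoring A a c) (ha : 3 ≤ a) (u v : V) :
    ∃ w, w ≠ u ∧ w ≠ v ∧ c w = c u := by
  classical
  have h : (({u, v} : Finset V)).card < (univ.filter fun z => c z = c u).card := by
    rw [hc.card]
    exact card_le_two.trans_lt ha
  obtain ⟨w, hw, hw'⟩ := exists_mem_notMem_of_card_lt_card h
  simp only [mem_insert, mem_singleton, not_or] at hw'
  exact ⟨w, hw'.1, hw'.2, by simpa using hw⟩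

variable [DecidableRel A]

theorem BalancedColoring.outDeg_le (hc : BalancedColoring A a c) (u : V) : outDeg A u ≤ a :=
  hc.card_le (b := !c u) fun v hv => hc.arc u v (by simpa using hv)

theorem BalancedColoring.inDeg_le (hc : BalancedColoring A a c) (u : V) : inDeg A u ≤ a :=
  hc.card_le (b := !c u) fun v hv => hc.arc' (by simpa using hv)

theorem BalancedColoring.outDeg_lt (hc : BalancedColoring A a c) {u v : V} (hv : c v = !c u)
    (h : ¬ A u v) : outDeg A u < a :=
  hc.card_lt (b := !c u) (fun v hv => hc.arc u v (by simpa using hv)) hv (by simpa using h)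

theorem BalancedColoring.inDeg_lt (hc : BalancedColoring A a c) {u v : V} (hv : c v = !c u)
    (h : ¬ A v u) : inDeg A u < a :=
  hc.card_lt (b := !c u) (fun v hv => hc.arc' (by simpa using hv)) hv (by simpa using h)

theorem outDeg_le_one {u : V} (h : ∀ v w, A u v → A u w → v = w) : outDeg A u ≤ 1 := by
  rw [outDeg, card_le_one]
  intro v hv w hw
  exact h v w (by simpa using hv) (by simpa using hw)

theorem inDeg_le_one {u : V} (h : ∀ v w, A v u → A w u → v = w) : inDeg A u ≤ 1 := by
  rw [inDeg, card_le_one]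
  intro v hv w hw
  exact h v w (by simpa using hv) (by simpa using hw)

theorem outDeg_eq_card_perm (σ : Equiv.Perm V) (v : V) :
    outDeg A v = (univ.filter fun x => A v (σ x)).card :=
  (Finset.card_equiv σ fun x => by simp).symm

/-- The degree-sum condition over all pairs of distinct vertices with a common neighbour. -/
def DegreeSum (A : V → V → Prop) [DecidableRel A] (a : ℕ) : Prop :=
  ∀ u v : V, u ≠ v → ShareNeighbor A u v → 3 * a ≤ deg A u + deg A v

/-- If no vertex shares a neighbour with `u`, all arcs at `u` are forced and the same holds
for the out-neighbour of `u`. -/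
theorem unpaired_step (hc : BalancedColoring A a c) (ha : 3 ≤ a) (hd : DegreeSum A a)
    {u w : V} (hu : ∀ v, v ≠ u → ¬ ShareNeighbor A u v) (huw : A u w) :
    (∀ w', A u w' → w' = w) ∧ (∀ v, A v w → v = u) ∧ ∀ v, v ≠ w → ¬ ShareNeighbor A w v := by
  have h1 : ∀ w', A u w' → ∀ v, A v w' → v = u := by
    intro w' hw' v hv
    by_contra hne
    exact hu v hne (Or.inr ⟨w', hw', hv⟩)
  have h2 : ∀ v, A v u → ∀ w', A v w' → w' = u := by
    intro v hv w' hw'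
    by_contra hne
    exact hu w' hne (Or.inl ⟨v, hv, hw'⟩)
  have h3 : ∀ w', A u w' → inDeg A w' ≤ 1 := fun w' hw' =>
    inDeg_le_one fun x y hx hy => (h1 w' hw' x hx).trans (h1 w' hw' y hy).symm
  have h4 : ∀ v, A v u → outDeg A v ≤ 1 := fun v hv =>
    outDeg_le_one fun x y hx hy => (h2 v hv x hx).trans (h2 v hv y hy).symm
  refine ⟨?_, h1 w huw, ?_⟩
  · intro w' hw'
    by_contra hne
    have := hd w' w hne (Or.inl ⟨u, hw', huw⟩)
    have := h3 w huw
    have := h3 w' hw'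
    have := hc.outDeg_le w
    have := hc.outDeg_le w'
    unfold deg at *
    omega
  · intro v hvw hsh
    have hsum := hd w v hvw.symm hsh
    have hw := h3 w huw
    have hw' := hc.outDeg_le w
    have hv := hc.inDeg_le v
    have hcol : c u = !c v := by
      rcases hsh with ⟨z, hz1, hz2⟩ | ⟨z, hz1, hz2⟩
      · rw [h1 w huw z hz1] at hz2
        exact hc.arc' hz2
      · have e1 := hc.arc _ _ hz1
        have e2 := hc.arc _ _ hz2
        have e3 := hc.arc _ _ huw
        rw [e1] at e2
        rw [e3] at e2
        simp only [Bool.not_not] at e2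
        exact e2
    have hnu : ¬ A u v := by
      intro h
      have := h3 v h
      have := hc.outDeg_le v
      unfold deg at *
      omega
    have hlt := hc.inDeg_lt hcol hnu
    have hvu : A v u := by
      by_contra h
      have := hc.outDeg_lt hcol h
      unfold deg at *
      omega
    have := h4 v hvu
    unfold deg at *
    omega

end Degrees

section Hamiltonian

theorem pow_succ_apply {V : Type*} (σ : Equiv.Perm V) (i : ℕ) (v : V) :
    (σ ^ (i + 1)) v = σ ((σ ^ i) v) := by
  rw [pow_succ', Equiv.Perm.mul_apply]

variable {V : Type*} [Fintype V] {A : V → V → Prop} {σ : Equiv.Perm V}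

theorem isCycleOn_univ (hσ : ∀ u v, σ.SameCycle u v) :
    σ.IsCycleOn ((univ : Finset V) : Set V) :=
  ⟨by simp, fun x _ y _ => hσ x y⟩

theorem pow_apply_eq_iff (hσ : ∀ u v, σ.SameCycle u v) (v : V) (i j : ℕ) :
    (σ ^ i) v = (σ ^ j) v ↔ i ≡ j [MOD Fintype.card V] :=
  (isCycleOn_univ hσ).pow_apply_eq_pow_apply (mem_univ v)

theorem pow_apply_inj (hσ : ∀ u v, σ.SameCycle u v) (v : V) {i j : ℕ}
    (hi : i < Fintype.card V) (hj : j < Fintype.card V) (h : (σ ^ i) v = (σ ^ j) v) : i = j :=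
  Nat.ModEq.eq_of_lt_of_lt ((pow_apply_eq_iff hσ v i j).1 h) hi hj

theorem pow_card_apply (hσ : ∀ u v, σ.SameCycle u v) (v : V) :
    (σ ^ Fintype.card V) v = v := by
  have := (pow_apply_eq_iff hσ v (Fintype.card V) 0).2 (by simp [Nat.ModEq])
  simpa using this

theorem exists_pow_apply_eq (hσ : ∀ u v, σ.SameCycle u v) (u v : V) :
    ∃ i < Fintype.card V, (σ ^ i) u = v :=
  (isCycleOn_univ hσ).exists_pow_eq (mem_univ u) (mem_univ v)

/-- A stretch of a Hamiltonian cycle that is closed up by a chord is a cycle. -/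
theorem cycleSeq_pow (hσ : ∀ u v, σ.SameCycle u v) (hA : ∀ v, A v (σ v)) (v : V) {n : ℕ}
    (hn : n ≤ Fintype.card V) (hchord : A ((σ ^ (n - 1)) v) v) :
    CycleSeq A n (fun i => (σ ^ i) v) where
  inj i hi j hj h := pow_apply_inj hσ v (hi.trans_le hn) (hj.trans_le hn) h
  arc i _ := by
    simp only [pow_succ_apply]
    exact hA _
  close := by simpa using hchord

theorem cycleSeq_card (hσ : ∀ u v, σ.SameCycle u v) (hA : ∀ v, A v (σ v)) (v : V) :
    CycleSeq A (Fintype.card V) (fun i => (σ ^ i) v) := by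
  refine cycleSeq_pow hσ hA v le_rfl ?_
  have hpos : 0 < Fintype.card V := Fintype.card_pos_iff.2 ⟨v⟩
  have h := pow_succ_apply σ (Fintype.card V - 1) v
  rw [Nat.sub_add_cancel hpos, pow_card_apply hσ] at h
  have h' := hA ((σ ^ (Fintype.card V - 1)) v)
  rwa [← h] at h'

theorem isDirectedCycle_of_unique_out (hs : StrongConn A) (hcard : 2 ≤ Fintype.card V)
    (hA : ∀ v, A v (σ v)) (huniq : ∀ u v, A u v → v = σ u) : IsDirectedCycle A := by
  have hσ : ∀ u v, σ.SameCycle u v := fun u v =>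
    hs.mem_of_closed (P := fun v => σ.SameCycle u v)
      (fun x y hx hxy => by rw [huniq x y hxy]; exact Equiv.Perm.sameCycle_apply_right.2 hx)
      (Equiv.Perm.SameCycle.refl σ u) v
  obtain ⟨v₀⟩ : Nonempty V := Fintype.card_pos_iff.1 (by omega)
  obtain ⟨f, hf, hfA, hr⟩ := (cycleSeq_card hσ hA v₀).exists_zmod hcard
  have hsurj : Function.Surjective f := fun v => (hr v).2 (exists_pow_apply_eq hσ v₀ v)
  let e := Equiv.ofBijective f ⟨hf, hsurj⟩
  refine ⟨e.symm, fun u v => ?_⟩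
  obtain ⟨i, rfl⟩ := e.surjective u
  obtain ⟨j, rfl⟩ := e.surjective v
  rw [e.symm_apply_apply, e.symm_apply_apply]
  have hi : A (e i) (e (i + 1)) := hfA i
  constructor
  · intro h
    exact e.injective ((huniq _ _ h).trans (huniq _ _ hi).symm)
  · rintro rfl
    exact hi

end Hamiltonian

section MinimumDegree

variable {V : Type*} [Fintype V] {A : V → V → Prop} [DecidableRel A] {a : ℕ} {c : V → Bool}

theorem exists_shareNeighbor (hc : BalancedColoring A a c) (ha : 3 ≤ a) (hd : DegreeSum A a)
    (hs : StrongConn A) (hnc : ¬ IsDirectedCycle A) (u : V) :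
    ∃ v, v ≠ u ∧ ShareNeighbor A u v := by
  by_contra! hu
  have hall : ∀ w v, v ≠ w → ¬ ShareNeighbor A w v :=
    hs.mem_of_closed (fun x y hx hxy => (unpaired_step hc ha hd hx hxy).2.2) hu
  have hout : ∀ v, ∃ w, A v w := fun v => by
    obtain ⟨w, hw, -⟩ := hc.exists_ne (by omega) v
    exact exists_out hs hw.symm
  choose s hs' using hout
  have hinj : Function.Injective s := fun x y hxy =>
    ((unpaired_step hc ha hd (hall x) (hs' x)).2.1 y (by rw [hxy]; exact hs' y)).symm
  refine hnc (isDirectedCycle_of_unique_out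
    (σ := Equiv.ofBijective s (Finite.injective_iff_bijective.1 hinj)) hs ?_ hs' ?_)
  · have := hc.card true
    have := card_le_univ (univ.filter fun v => c v = true)
    omega
  · intro x y hxy
    exact (unpaired_step hc ha hd (hall x) (hs' x)).1 y hxy

theorem BalancedColoring.le_deg (hc : BalancedColoring A a c) (ha : 3 ≤ a) (hd : DegreeSum A a)
    (hs : StrongConn A) (hnc : ¬ IsDirectedCycle A) (u : V) : a ≤ deg A u := by
  obtain ⟨v, hv, h⟩ := exists_shareNeighbor hc ha hd hs hnc u
  have := hd u v hv.symm h
  have := hc.outDeg_le v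
  have := hc.inDeg_le v
  unfold deg at *
  omega

end MinimumDegree

section Matching

variable {V : Type*} [Fintype V] [DecidableEq V] {A : V → V → Prop} [DecidableRel A] {a : ℕ}
  {c : V → Bool}

theorem card_le_card_out_of_color (hc : BalancedColoring A a c) (hd : DegreeSum A a)
    (hout : ∀ v, ∃ w, A v w) (hin : ∀ v, ∃ w, A w v) {b : Bool} (S : Finset V)
    (hS : ∀ v ∈ S, c v = b) :
    S.card ≤ (S.biUnion fun v => univ.filter fun w => A v w).card := by
  set N := S.biUnion fun v => univ.filter fun w => A v w with hN
  have memN : ∀ w, w ∈ N ↔ ∃ v ∈ S, A v w := fun w => by simp [hN]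
  have hNc : ∀ w ∈ N, c w = !b := fun w hw => by
    obtain ⟨v, hv, h⟩ := (memN w).1 hw
    rw [hc.arc v w h, hS v hv]
  by_contra! hlt
  choose f hf using hout
  choose g hg using hin
  have hSa : S.card ≤ a := hc.card_le hS
  obtain ⟨s, hs, s', hs', hne, hss⟩ := exists_ne_map_eq_of_card_lt_of_maps_to hlt (f := f)
    (fun v hv => (memN _).2 ⟨v, hv, hf v⟩)
  have h1 := hd s s' hne (Or.inr ⟨f s, hf s, by rw [hss]; exact hf s'⟩)
  have hdN : ∀ v ∈ S, outDeg A v ≤ N.card := fun v hv =>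
    card_le_card fun w hw => (memN w).2 ⟨v, hv, by simpa using hw⟩
  have h2 := hdN s hs
  have h3 := hdN s' hs'
  have h4 := hc.inDeg_le s
  have h5 := hc.inDeg_le s'
  set T := (univ.filter fun v => c v = !b) \ N with hT
  set S' := (univ.filter fun v => c v = b) \ S with hS'
  have hTcard : T.card + N.card = a := by
    rw [← hc.card (!b), hT]
    exact card_sdiff_add_card_eq_card fun w hw => by simpa using hNc w hw
  have hScard : S'.card + S.card = a := by
    rw [← hc.card b, hS']
    exact card_sdiff_add_card_eq_card fun w hw => by simpa using hS w hw
  have hTin : ∀ t ∈ T, ∀ v, A v t → v ∈ S' := by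
    intro t ht v hv
    rw [hT, mem_sdiff, mem_filter] at ht
    rw [hS', mem_sdiff, mem_filter]
    refine ⟨⟨mem_univ _, ?_⟩, fun h => ht.2 ((memN t).2 ⟨v, h, hv⟩)⟩
    rw [hc.arc' hv, ht.1.2, Bool.not_not]
  obtain ⟨t, ht, t', ht', hne', htt⟩ := exists_ne_map_eq_of_card_lt_of_maps_to
    (show S'.card < T.card by omega) (f := g) (fun v hv => hTin v hv _ (hg v))
  have h6 := hd t t' hne' (Or.inl ⟨g t, hg t, by rw [htt]; exact hg t'⟩)
  have hdS : ∀ v ∈ T, inDeg A v ≤ S'.card := fun v hv =>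
    card_le_card fun w hw => hTin v hv w (by simpa using hw)
  have h7 := hdS t ht
  have h8 := hdS t' ht'
  have h9 := hc.outDeg_le t
  have h10 := hc.outDeg_le t'
  unfold deg at *
  omega

theorem exists_factor (hc : BalancedColoring A a c) (hd : DegreeSum A a)
    (hout : ∀ v, ∃ w, A v w) (hin : ∀ v, ∃ w, A w v) :
    ∃ σ : Equiv.Perm V, ∀ v, A v (σ v) := by
  obtain ⟨f, hf, hfA⟩ := (all_card_le_biUnion_card_iff_exists_injective
    (fun v : V => univ.filter fun w => A v w)).1 fun S => by
      have h1 := card_le_card_out_of_color hc hd hout hin (b := true) (S.filter fun v => c v = true)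
        fun v hv => (mem_filter.1 hv).2
      have h2 := card_le_card_out_of_color hc hd hout hin (b := false)
        (S.filter fun v => ¬ c v = true) fun v hv => by simpa using (mem_filter.1 hv).2
      rw [← card_filter_add_card_filter_not (s := S) (fun v => c v = true)]
      refine (add_le_add h1 h2).trans ?_
      rw [← card_union_of_disjoint]
      · refine card_le_card fun w hw => ?_
        simp only [mem_union, mem_biUnion, mem_filter, mem_univ, true_and] at hw ⊢
        rcases hw with ⟨v, ⟨h, -⟩, h'⟩ | ⟨v, ⟨h, -⟩, h'⟩ <;> exact ⟨v, h, h'⟩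
      · rw [disjoint_left]
        intro w hw hw'
        simp only [mem_biUnion, mem_filter, mem_univ, true_and] at hw hw'
        obtain ⟨v, ⟨-, h⟩, h1⟩ := hw
        obtain ⟨v', ⟨-, h'⟩, h2⟩ := hw'
        have e1 := hc.arc' h1
        have e2 := hc.arc' h2
        rw [← e2] at e1
        exact h' (e1 ▸ h)
  refine ⟨Equiv.ofBijective f (Finite.injective_iff_bijective.1 hf), fun v => ?_⟩
  simpa using hfA v

end Matching

section Merging

variable {V : Type*} [Fintype V] {A : V → V → Prop} {a : ℕ} {c : V → Bool} {σ : Equiv.Perm V}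

theorem SameCycle.iff_of_invariant {S : V → Prop} (hS : ∀ v, S (σ v) ↔ S v) {x y : V}
    (h : σ.SameCycle x y) : S x ↔ S y := by
  obtain ⟨i, -, -, rfl⟩ := h.exists_pow_eq''
  induction i with
  | zero => simp
  | succ n ih => rw [pow_succ_apply, hS, ← ih ⟨n, by rw [zpow_natCast]⟩]

theorem card_filter_color_of_invariant (hc : BalancedColoring A a c) (hA : ∀ v, A v (σ v))
    {O : Finset V} (hO : ∀ v, σ v ∈ O ↔ v ∈ O) (b : Bool) :
    2 * (O.filter fun v => c v = b).card = O.card := by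
  have h1 : (O.filter fun v => c v = b).card = (O.filter fun v => ¬ c v = b).card := by
    refine Finset.card_equiv σ fun v => ?_
    rw [mem_filter, mem_filter, hO, hc.arc _ _ (hA v)]
    cases c v <;> cases b <;> simp
  have h2 := card_filter_add_card_filter_not (s := O) (fun v => c v = b)
  omega

variable [DecidableEq V]

/-- If all possible arcs are present inside a union `S` of cycles of the factor, then the
cycles in `S` may be relabelled, which forbids further pairs of arcs. -/
theorem MaxFactor.not_merge_of_complete (hσ : MaxFactor A σ) (hc : BalancedColoring A a c)
    {S : V → Prop} (hS : ∀ v, S (σ v) ↔ S v) (hcomp : ∀ s t, S s → S t → c t = !c s → A s t)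
    {u v x : V} (hu : S u) (hv : S v) (huv : c v = c u) (hx : ¬ S x) :
    ¬ (A x (σ v) ∧ A u (σ x)) := by
  have hσc : ∀ z, c (σ z) = !c z := fun z => hc.arc _ _ (hσ.arc z)
  set τ := Equiv.swap (σ v) (σ u) with hτ
  have hτS : ∀ z, S (τ z) ↔ S z := by
    intro z
    rw [hτ, Equiv.swap_apply_def]
    split_ifs with h1 h2
    · rw [h1, hS, hS]; simp [hu, hv]
    · rw [h2, hS, hS]; simp [hu, hv]
    · rfl
  have hτc : ∀ z, c (τ z) = c z := by
    intro z
    rw [hτ, Equiv.swap_apply_def]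
    split_ifs with h1 h2
    · rw [h1, hσc, hσc, huv]
    · rw [h2, hσc, hσc, huv]
    · rfl
  have hτx : ∀ z, ¬ S z → τ z = z := by
    intro z hz
    refine Equiv.swap_apply_of_ne_of_ne ?_ ?_ <;> rintro rfl <;> rw [hS] at hz
    · exact hz hv
    · exact hz hu
  have hτu : τ u = u := by
    refine Equiv.swap_apply_of_ne_of_ne ?_ ?_ <;> intro h <;> have := congrArg c h <;>
      simp [hσc, huv] at this
  have hτinv : τ⁻¹ = τ := by simp [hτ]
  have happ : ∀ z, (τ * σ * τ⁻¹) z = τ (σ (τ z)) := fun z => by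
    rw [hτinv, Equiv.Perm.mul_apply, Equiv.Perm.mul_apply]
  have hmax : MaxFactor A (τ * σ * τ⁻¹) := by
    refine ⟨fun z => ?_, fun π hπ => by rw [cyclePairs_conj]; exact hσ.max π hπ⟩
    rw [happ]
    by_cases hz : S z
    · exact hcomp _ _ hz (by rwa [hτS, hS, hτS]) (by rw [hτc, hσc, hτc])
    · rw [hτx z hz, hτx _ (by rwa [hS])]
      exact hσ.arc z
  have hns : ¬ (τ * σ * τ⁻¹).SameCycle x u := by
    rw [Equiv.Perm.sameCycle_conj, hτinv, hτx x hx, hτu]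
    exact fun h => hx ((SameCycle.iff_of_invariant hS h).2 hu)
  have := hmax.not_merge hns
  rwa [happ, happ, hτu, hτx x hx, hτx (σ x) (by rwa [hS]), Equiv.swap_apply_right] at this

variable [DecidableRel A]

theorem MaxFactor.inter_subset (hσ : MaxFactor A σ) (hc : BalancedColoring A a c)
    {O : Finset V} (hO : ∀ v, σ v ∈ O ↔ v ∈ O) {v : V} (hv : v ∈ O) :
    (univ.filter fun x => A v (σ x)) ∩ (univ.filter fun x => A x (σ v)) ⊆
      O.filter fun x => c x = c v := by
  intro x hx
  simp only [mem_inter, mem_filter, mem_univ, true_and] at hx ⊢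
  constructor
  · by_contra hxO
    refine hσ.not_merge (x := v) (y := x) (fun h => hxO ?_) hx
    exact (SameCycle.iff_of_invariant (S := fun x => x ∈ O) hO h).1 hv
  · rw [hc.arc' hx.2, hc.arc' (hσ.arc v)]

theorem MaxFactor.union_subset (hσ : MaxFactor A σ) (hc : BalancedColoring A a c) (v : V) :
    (univ.filter fun x => A v (σ x)) ∪ (univ.filter fun x => A x (σ v)) ⊆
      univ.filter fun x => c x = c v := by
  intro x hx
  simp only [mem_union, mem_filter, mem_univ, true_and] at hx ⊢
  rcases hx with h | h
  · rw [hc.arc' (hσ.arc x), hc.arc' h]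
  · rw [hc.arc' h, hc.arc' (hσ.arc v)]

theorem MaxFactor.outDeg_add_inDeg_le (hσ : MaxFactor A σ) (hc : BalancedColoring A a c)
    {O : Finset V} (hO : ∀ v, σ v ∈ O ↔ v ∈ O) {v : V} (hv : v ∈ O) :
    outDeg A v + inDeg A (σ v) ≤ a + (O.filter fun x => c x = c v).card := by
  rw [outDeg_eq_card_perm σ, inDeg, ← card_union_add_card_inter, ← hc.card (c v)]
  exact add_le_add (card_le_card (hσ.union_subset hc v)) (card_le_card (hσ.inter_subset hc hO hv))

theorem MaxFactor.arcs_of_eq (hσ : MaxFactor A σ) (hc : BalancedColoring A a c)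
    {O : Finset V} (hO : ∀ v, σ v ∈ O ↔ v ∈ O) {v : V} (hv : v ∈ O)
    (heq : outDeg A v + inDeg A (σ v) = a + (O.filter fun x => c x = c v).card)
    {x : V} (hx : c x = c v) :
    (x ∈ O → A v (σ x)) ∧ (A v (σ x) ∨ A x (σ v)) := by
  rw [outDeg_eq_card_perm σ, inDeg, ← card_union_add_card_inter, ← hc.card (c v)] at heq
  have hu := card_le_card (hσ.union_subset hc v)
  have hi := card_le_card (hσ.inter_subset hc hO hv)
  have hu' := eq_of_subset_of_card_le (hσ.union_subset hc v) (by omega)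
  have hi' := eq_of_subset_of_card_le (hσ.inter_subset hc hO hv) (by omega)
  constructor
  · intro hxO
    have : x ∈ O.filter fun x => c x = c v := mem_filter.2 ⟨hxO, hx⟩
    rw [← hi'] at this
    simp only [mem_inter, mem_filter, mem_univ, true_and] at this
    exact this.1
  · have : x ∈ univ.filter fun x => c x = c v := mem_filter.2 ⟨mem_univ _, hx⟩
    rw [← hu'] at this
    simpa using this

/-- The degree-sum condition over all pairs of distinct vertices of the same colour. -/
def ColorDegreeSum (A : V → V → Prop) [DecidableRel A] (a : ℕ) (c : V → Bool) : Prop :=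
  ∀ u v : V, u ≠ v → c u = c v → 3 * a ≤ deg A u + deg A v

theorem MaxFactor.eq_of_card_le (hσ : MaxFactor A σ) (hc : BalancedColoring A a c)
    (hP : ColorDegreeSum A a c) (h2 : ∀ v, σ (σ v) ≠ v)
    {O : Finset V} (hO : ∀ v, σ v ∈ O ↔ v ∈ O) (hne : O.Nonempty) (hcard : O.card ≤ a) :
    O.card = a ∧ ∀ v ∈ O, outDeg A v + inDeg A (σ v) =
      a + (O.filter fun x => c x = c v).card := by
  have hσc : ∀ z, c (σ z) = !c z := fun z => hc.arc _ _ (hσ.arc z)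
  have hle : ∀ v ∈ O, outDeg A v + inDeg A (σ v) ≤ a + (O.filter fun x => c x = c v).card :=
    fun v hv => hσ.outDeg_add_inDeg_le hc hO hv
  have hsum1 : ∑ v ∈ O, (outDeg A v + inDeg A (σ v)) = ∑ v ∈ O, deg A v := by
    unfold deg
    rw [sum_add_distrib, sum_add_distrib]
    congr 1
    exact Finset.sum_equiv σ (fun v => (hO v).symm) fun _ _ => rfl
  have hsum2 : ∑ v ∈ O, deg A (σ (σ v)) = ∑ v ∈ O, deg A v :=
    Finset.sum_equiv (σ * σ) (fun v => by simp [hO]) fun _ _ => rfl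
  have hlow : O.card * (3 * a) ≤ 2 * ∑ v ∈ O, deg A v := by
    rw [two_mul]
    nth_rewrite 2 [← hsum2]
    rw [← sum_add_distrib, ← smul_eq_mul]
    exact Finset.card_nsmul_le_sum _ _ _ fun v _ => hP _ _ (h2 v).symm (by simp [hσc])
  have hup : 2 * ∑ v ∈ O, (a + (O.filter fun x => c x = c v).card) = O.card * (2 * a + O.card) := by
    rw [mul_sum, ← smul_eq_mul (a := O.card)]
    refine Finset.sum_eq_card_nsmul fun v _ => ?_
    rw [mul_add, card_filter_color_of_invariant hc hσ.arc hO]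
  have hsle := Finset.sum_le_sum hle
  have hpos : 0 < O.card := hne.card_pos
  have hmul : O.card * (3 * a) ≤ O.card * (2 * a + O.card) := by
    rw [← hup]
    omega
  have hge := Nat.le_of_mul_le_mul_left hmul hpos
  have hOa : O.card = a := by omega
  refine ⟨hOa, (Finset.sum_eq_sum_iff_of_le hle).1 (le_antisymm hsle ?_)⟩
  have : 2 * ∑ v ∈ O, (a + (O.filter fun x => c x = c v).card) ≤ 2 * ∑ v ∈ O, deg A v := by
    rw [hup]
    refine le_trans (le_of_eq ?_) hlow
    rw [hOa]; ring
  omega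

/-- Two complementary halves of a maximal factor, each meeting the counting bound with
equality, are incompatible with strong connectivity. -/
theorem MaxFactor.not_two_halves (hσ : MaxFactor A σ) (hc : BalancedColoring A a c) (ha : 1 ≤ a)
    (hs : StrongConn A) (hP : ColorDegreeSum A a c) (h2 : ∀ v, σ (σ v) ≠ v)
    {O : Finset V} (hO : ∀ v, σ v ∈ O ↔ v ∈ O) (hcard : O.card = a) (hcard' : Oᶜ.card = a) :
    False := by
  have hσc : ∀ z, c (σ z) = !c z := fun z => hc.arc _ _ (hσ.arc z)
  have hO' : ∀ v, σ v ∈ Oᶜ ↔ v ∈ Oᶜ := fun v => by rw [mem_compl, mem_compl, hO]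
  have hne : O.Nonempty := card_pos.1 (by omega)
  have hne' : Oᶜ.Nonempty := card_pos.1 (by omega)
  have hsym : ∀ {w : V}, σ (σ.symm w) = w := fun {w} => σ.apply_symm_apply w
  have hsymc : ∀ w, c (σ.symm w) = !c w := fun w => by
    have := hσc (σ.symm w)
    rw [hsym] at this
    simp [this]
  have complete : ∀ Q : Finset V, (∀ v, σ v ∈ Q ↔ v ∈ Q) → Q.Nonempty → Q.card = a →
      ∀ s t, s ∈ Q → t ∈ Q → c t = !c s → A s t := by
    intro Q hQ hQne hQa s t hs' ht hst
    have := (hσ.arcs_of_eq hc hQ hs' ((hσ.eq_of_card_le hc hP h2 hQ hQne hQa.le).2 s hs')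
      (x := σ.symm t) (by rw [hsymc, hst, Bool.not_not])).1 (by rwa [← hQ, hsym])
    rwa [hsym] at this
  have hcomp := complete O hO hne hcard
  have hcomp' := complete Oᶜ hO' hne' hcard'
  have hor : ∀ v ∈ O, ∀ x, c x = c v → A v (σ x) ∨ A x (σ v) := fun v hv x hx =>
    (hσ.arcs_of_eq hc hO hv ((hσ.eq_of_card_le hc hP h2 hO hne hcard.le).2 v hv) hx).2
  have flex : ∀ u v x, u ∈ O → v ∈ O → x ∉ O → c v = c u → ¬ (A x (σ v) ∧ A u (σ x)) :=
    fun u v x hu hv hx huv => hσ.not_merge_of_complete hc (S := fun z => z ∈ O) hO hcomp hu hv huv hx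
  have flex' : ∀ u v x, u ∉ O → v ∉ O → x ∈ O → c v = c u → ¬ (A x (σ v) ∧ A u (σ x)) :=
    fun u v x hu hv hx huv => hσ.not_merge_of_complete hc (S := fun z => z ∈ Oᶜ) hO' hcomp'
      (by simpa using hu) (by simpa using hv) huv (by simpa using hx)
  have spread : ∀ v w x x', v ∈ O → w ∈ O → x ∉ O → x' ∉ O → c w = c v → c x = c v →
      c x' = c v → A v (σ x) → A w (σ x') := by
    intro v w x x' hv hw hx hx' hwv hxv hxv' h
    have h1 : ¬ A x' (σ v) := fun h' => flex' x' x v hx' hx hv (by rw [hxv, hxv']) ⟨h, h'⟩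
    have h3 : A v (σ x') := (hor v hv x' hxv').resolve_right h1
    have h4 : ¬ A x' (σ w) := fun h' => flex v w x' hv hw hx' hwv ⟨h', h3⟩
    exact (hor w hw x' (by rw [hxv', hwv])).resolve_right h4
  have dich : ∀ b, (∀ v ∈ O, ∀ x, x ∉ O → c v = b → c x = b → ¬ A x (σ v)) ∨
      (∀ v ∈ O, ∀ x, x ∉ O → c v = b → c x = b → ¬ A v (σ x)) := by
    intro b
    by_contra! h
    obtain ⟨⟨v, hv, x, hx, hvb, hxb, h1⟩, w, hw, x', hx', hwb, hxb', h3⟩ := h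
    refine flex v v x hv hv hx rfl ⟨h1, spread w v x' x hw hv hx' hx ?_ ?_ ?_ h3⟩ <;>
      simp [*]
  have mixed : ∀ b, (∀ v ∈ O, ∀ x, x ∉ O → c v = b → c x = b → ¬ A x (σ v)) →
      (∀ v ∈ O, ∀ x, x ∉ O → c v = (!b) → c x = (!b) → ¬ A v (σ x)) → False := by
    intro b h1 h3
    have hdeg : ∀ x, x ∉ O → c x = b → deg A x ≤ a := by
      intro x hx hxb
      have hout : outDeg A x ≤ (Oᶜ.filter fun v => c v = !b).card := by
        refine card_le_card fun w hw => ?_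
        have hw : A x w := by simpa using hw
        have hwc : c w = !b := by rw [hc.arc _ _ hw, hxb]
        rw [mem_filter, mem_compl]
        refine ⟨fun hwO => h1 (σ.symm w) (by rwa [← hO, hsym]) x hx ?_ hxb (by rwa [hsym]), hwc⟩
        rw [hsymc, hwc, Bool.not_not]
      have hin : inDeg A x ≤ (Oᶜ.filter fun v => c v = !b).card := by
        refine card_le_card fun w hw => ?_
        have hw : A w x := by simpa using hw
        have hwc : c w = !b := by rw [hc.arc' hw, hxb]
        rw [mem_filter, mem_compl]
        refine ⟨fun hwO => h3 w hwO (σ.symm x) (by rwa [← hO, hsym]) hwc ?_ (by rwa [hsym]), hwc⟩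
        rw [hsymc, hxb]
      have := card_filter_color_of_invariant hc hσ.arc hO' (!b)
      unfold deg
      omega
    obtain ⟨x, hx, hxb⟩ : ∃ x, x ∉ O ∧ c x = b := by
      obtain ⟨x, hx⟩ := hne'
      by_cases h : c x = b
      · exact ⟨x, by simpa using hx, h⟩
      · refine ⟨σ x, by rw [hO]; simpa using hx, ?_⟩
        rw [hσc]
        revert h
        cases c x <;> cases b <;> simp
    have e1 := hdeg x hx hxb
    have e2 := hdeg (σ (σ x)) (by rwa [hO, hO]) (by rw [hσc, hσc, hxb, Bool.not_not])
    have := hP x (σ (σ x)) (h2 x).symm (by simp [hσc])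
    omega
  rcases dich true with ht | ht <;> rcases dich false with hf | hf
  · obtain ⟨x, hx⟩ := hne'
    obtain ⟨y, hy⟩ := hne
    have := hs.mem_of_closed (P := fun z => z ∉ O) (fun u w hu huw hw => ?_)
      (by simpa using hx) y
    · exact this hy
    · have hwO : σ.symm w ∈ O := by rwa [← hO, hsym]
      have hcc : c (σ.symm w) = c u := by rw [hsymc, hc.arc _ _ huw, Bool.not_not]
      cases hcu : c u
      · exact hf _ hwO u hu (by rw [hcc, hcu]) hcu (by rwa [hsym])
      · exact ht _ hwO u hu (by rw [hcc, hcu]) hcu (by rwa [hsym])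
  · exact mixed true ht hf
  · exact mixed false hf ht
  · obtain ⟨x, hx⟩ := hne'
    obtain ⟨y, hy⟩ := hne
    have := hs.mem_of_closed (P := fun z => z ∈ O) (fun u w hu huw => ?_) hy x
    · exact (mem_compl.1 hx) this
    · by_contra hw
      have hwO : σ.symm w ∉ O := by rwa [← hO, hsym]
      have hcc : c (σ.symm w) = c u := by rw [hsymc, hc.arc _ _ huw, Bool.not_not]
      cases hcu : c u
      · exact hf u hu _ hwO hcu (by rw [hcc, hcu]) (by rwa [hsym])
      · exact ht u hu _ hwO hcu (by rw [hcc, hcu]) (by rwa [hsym])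

end Merging

section TwoCycles

variable {V : Type*} [Fintype V] {A : V → V → Prop} [DecidableRel A] {a : ℕ} {c : V → Bool}

theorem BalancedColoring.outDeg_add_card (hc : BalancedColoring A a c) (u : V) :
    outDeg A u + (univ.filter fun v => c v = !c u ∧ ¬ A u v).card = a :=
  hc.card_add_card_not fun v h => hc.arc u v h

theorem BalancedColoring.inDeg_add_card (hc : BalancedColoring A a c) (u : V) :
    inDeg A u + (univ.filter fun v => c v = !c u ∧ ¬ A v u).card = a :=
  hc.card_add_card_not fun _ h => hc.arc' h

theorem BalancedColoring.outDeg_add_two_le (hc : BalancedColoring A a c) {u v w : V}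
    (hv : c v = !c u) (hw : c w = !c u) (hvw : v ≠ w) (h : ¬ A u v) (h' : ¬ A u w) :
    outDeg A u + 2 ≤ a := by
  have := hc.outDeg_add_card u
  have : 1 < (univ.filter fun v => c v = !c u ∧ ¬ A u v).card :=
    one_lt_card.2 ⟨v, by simp [*], w, by simp [*], hvw⟩
  omega

theorem BalancedColoring.inDeg_add_two_le (hc : BalancedColoring A a c) {u v w : V}
    (hv : c v = !c u) (hw : c w = !c u) (hvw : v ≠ w) (h : ¬ A v u) (h' : ¬ A w u) :
    inDeg A u + 2 ≤ a := by
  have := hc.inDeg_add_card u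
  have : 1 < (univ.filter fun v => c v = !c u ∧ ¬ A v u).card :=
    one_lt_card.2 ⟨v, by simp [*], w, by simp [*], hvw⟩
  omega

/-- A vertex whose degree misses the maximum by at most one has at most one missing arc. -/
theorem BalancedColoring.arc_of_not_arc (hc : BalancedColoring A a c) {u v w : V}
    (hdeg : 2 * a ≤ deg A u + 1) (hv : c v = !c u) (hw : c w = !c u) (hvw : v ≠ w)
    (h : ¬ A u v ∨ ¬ A v u) : A u w ∧ A w u := by
  have h1 := hc.outDeg_le u
  have h2 := hc.inDeg_le u
  unfold deg at hdeg
  constructor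
  · by_contra h3
    have := hc.outDeg_lt hw h3
    rcases h with h | h
    · have := hc.outDeg_add_two_le hv hw hvw h h3
      omega
    · have := hc.inDeg_lt hv h
      omega
  · by_contra h3
    have := hc.inDeg_lt hw h3
    rcases h with h | h
    · have := hc.outDeg_lt hv h
      omega
    · have := hc.inDeg_add_two_le hv hw hvw h h3
      omega

variable [DecidableEq V] {σ : Equiv.Perm V}

/-- In a maximal factor, a cycle of length two which leaves the rest of the digraph complete
contradicts strong connectivity. -/
theorem MaxFactor.not_two_cycle_of_complete (hσ : MaxFactor A σ) (hc : BalancedColoring A a c)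
    (ha : 3 ≤ a) (hs : StrongConn A) (hdeg : ∀ u, a ≤ deg A u) {v w : V} (hvw : σ v = w)
    (hwv : σ w = v)
    (hcomp : ∀ s t, s ≠ v ∧ s ≠ w → t ≠ v ∧ t ≠ w → c t = !c s → A s t) : False := by
  have hAvw : A v w := hvw ▸ hσ.arc v
  have hAwv : A w v := hwv ▸ hσ.arc w
  have hcw : c w = !c v := hc.arc _ _ hAvw
  have hS : ∀ z, (σ z ≠ v ∧ σ z ≠ w) ↔ (z ≠ v ∧ z ≠ w) := by
    intro z
    have e1 : σ z = v ↔ z = w := by rw [← hwv, σ.injective.eq_iff]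
    have e2 : σ z = w ↔ z = v := by rw [← hvw, σ.injective.eq_iff]
    rw [Ne, Ne, e1, e2, and_comm]
  have key : ∀ p q z u, (p = v ∧ q = w ∨ p = w ∧ q = v) → σ p = q → c q = !c p →
      z ≠ q → u ≠ p → A p z → A u q → False := by
    intro p q z u hpq hpq' hcq hz hu h1 h2
    have hcz : c z = !c p := hc.arc _ _ h1
    have hcu : c u = c p := by rw [hc.arc' h2, hcq, Bool.not_not]
    have hzp : z ≠ p := by rintro rfl; simp at hcz
    have huq : u ≠ q := by rintro rfl; simp [hcu] at hcq
    have hcs : c (σ.symm z) = c u := by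
      have := hc.arc' (hσ.arc (σ.symm z))
      rw [this, σ.apply_symm_apply, hcz, hcu, Bool.not_not]
    refine hσ.not_merge_of_complete hc (S := fun z => z ≠ v ∧ z ≠ w) hS hcomp (u := u)
      (v := σ.symm z) (x := p) ?_ ?_ hcs ?_ ⟨by rwa [σ.apply_symm_apply], by rwa [hpq']⟩
    · rcases hpq with ⟨rfl, rfl⟩ | ⟨rfl, rfl⟩
      exacts [⟨hu, huq⟩, ⟨huq, hu⟩]
    · rw [← hS, σ.apply_symm_apply]
      rcases hpq with ⟨rfl, rfl⟩ | ⟨rfl, rfl⟩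
      exacts [⟨hzp, hz⟩, ⟨hz, hzp⟩]
    · rcases hpq with ⟨rfl, rfl⟩ | ⟨rfl, rfl⟩ <;> simp
  obtain ⟨x, hxv, hxc⟩ := hc.exists_ne (by omega) v
  have hxw : x ≠ w := by rintro rfl; simp [hcw] at hxc
  have h1 : (∀ z, A v z → z = w) ∨ (∀ u, A u w → u = v) := by
    by_contra! h
    obtain ⟨⟨z, hz, hz'⟩, u, hu, hu'⟩ := h
    exact key v w z u (Or.inl ⟨rfl, rfl⟩) hvw hcw hz' hu' hz hu
  have h2 : (∀ z, A w z → z = v) ∨ (∀ u, A u v → u = w) := by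
    by_contra! h
    obtain ⟨⟨z, hz, hz'⟩, u, hu, hu'⟩ := h
    exact key w v z u (Or.inr ⟨rfl, rfl⟩) hwv (by simp [hcw]) hz' hu' hz hu
  have hdv := hdeg v
  have hdw := hdeg w
  unfold deg at hdv hdw
  rcases h1 with h1 | h1 <;> rcases h2 with h2 | h2
  · have := hs.mem_of_closed (P := fun z => z = v ∨ z = w) (u := v) (by
      rintro p q (rfl | rfl) h
      exacts [Or.inr (h1 q h), Or.inl (h2 q h)]) (Or.inl rfl) x
    tauto
  · have := outDeg_le_one (A := A) fun p q hp hq => (h1 p hp).trans (h1 q hq).symm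
    have := inDeg_le_one (A := A) fun p q hp hq => (h2 p hp).trans (h2 q hq).symm
    omega
  · have := inDeg_le_one (A := A) fun p q hp hq => (h1 p hp).trans (h1 q hq).symm
    have := outDeg_le_one (A := A) fun p q hp hq => (h2 p hp).trans (h2 q hq).symm
    omega
  · have := hs.mem_of_closed (P := fun z => z ≠ v ∧ z ≠ w) (u := x) (by
      rintro p q ⟨hp, hp'⟩ h
      refine ⟨?_, ?_⟩ <;> rintro rfl
      exacts [hp' (h2 p h), hp (h1 p h)]) ⟨hxv, hxw⟩ v
    exact this.1 rfl

theorem MaxFactor.not_two_cycle_of_deg_le (hσ : MaxFactor A σ) (hc : BalancedColoring A a c)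
    (ha : 3 ≤ a) (hs : StrongConn A) (hdeg : ∀ u, a ≤ deg A u) (hP : ColorDegreeSum A a c)
    {v w : V} (hvw : σ v = w) (hwv : σ w = v) (hle : deg A v + deg A w ≤ 2 * a + 2)
    (hv : deg A v ≤ a + 1) : False := by
  have hAvw : A v w := hvw ▸ hσ.arc v
  have hAwv : A w v := hwv ▸ hσ.arc w
  have hcw : c w = !c v := hc.arc _ _ hAvw
  have hin := hc.inDeg_add_card w
  have hout := hc.outDeg_add_card w
  rw [hcw, Bool.not_not] at hin hout
  set M := univ.filter fun x => c x = c v ∧ ¬ A x w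
  set M' := univ.filter fun x => c x = c v ∧ ¬ A w x
  have hMv : v ∉ M ∪ M' := by simp [M, M', hAvw, hAwv]
  have hX : ∀ x, x ≠ v → c x = c v → 3 * a ≤ deg A x + deg A v := fun x h h' => hP x v h h'
  have hdisj : Disjoint M M' := by
    rw [disjoint_left]
    intro x hx hx'
    simp only [M, M', mem_filter, mem_univ, true_and] at hx hx'
    have hxv : x ≠ v := by rintro rfl; exact hx.2 hAvw
    have := hX x hxv hx.1
    have := hc.outDeg_lt (u := x) (v := w) (by simp [hx.1, hcw]) hx.2
    have := hc.inDeg_lt (u := x) (v := w) (by simp [hx.1, hcw]) hx'.2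
    unfold deg at *
    omega
  have hcardU := card_union_of_disjoint hdisj
  have hdw : deg A w = outDeg A w + inDeg A w := rfl
  have hdv := hdeg v
  have hmiss : ∀ x, x ≠ v → c x = c v → ¬ A x w ∨ ¬ A w x := by
    intro x hx hxc
    by_contra! h
    have hlt : (M ∪ M').card + 2 ≤ a := by
      have hsub : insert v (insert x (M ∪ M')) ⊆ univ.filter fun z => c z = c v := by
        intro z hz
        simp only [M, M', mem_insert, mem_union, mem_filter, mem_univ, true_and] at hz ⊢
        rcases hz with rfl | rfl | h | h
        exacts [rfl, hxc, h.1, h.1]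
      have := card_le_card hsub
      rw [hc.card, card_insert_of_notMem, card_insert_of_notMem] at this
      · exact this
      · simp [M, M', h.1, h.2]
      · rw [mem_insert, not_or]
        exact ⟨hx.symm, hMv⟩
    have hempty : M ∪ M' = ∅ := by
      rw [eq_empty_iff_forall_notMem]
      intro z hz
      have hzv : z ≠ v := by rintro rfl; exact hMv hz
      simp only [M, M', mem_union, mem_filter, mem_univ, true_and] at hz
      have hzc : c z = c v := by tauto
      have := hX z hzv hzc
      have := hc.outDeg_le z
      have := hc.inDeg_le z
      have hz' : ¬ A z w ∨ ¬ A w z := by tauto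
      rcases hz' with h | h
      · have := hc.outDeg_lt (u := z) (v := w) (by simp [hzc, hcw]) h
        unfold deg at *
        omega
      · have := hc.inDeg_lt (u := z) (v := w) (by simp [hzc, hcw]) h
        unfold deg at *
        omega
    rw [hempty, card_empty] at hcardU
    omega
  refine hσ.not_two_cycle_of_complete hc ha hs hdeg hvw hwv ?_
  have hside : ∀ s t, s ≠ v → t ≠ w → c s = c v → c t = !c v → A s t ∧ A t s := by
    intro s t hsv htw hsc htc
    refine hc.arc_of_not_arc (v := w) ?_ (by rw [hsc, hcw]) (by rw [hsc, htc]) htw.symm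
      (hmiss s hsv hsc)
    have := hX s hsv hsc
    omega
  intro s t hs' ht hst
  by_cases h : c s = c v
  · exact (hside s t hs'.1 ht.2 h (by rw [hst, h])).1
  · have h' : c s = !c v := by
      revert h
      cases c s <;> cases c v <;> simp
    exact (hside t s ht.1 hs'.2 (by rw [hst, h', Bool.not_not]) h').2

theorem MaxFactor.not_two_cycle (hσ : MaxFactor A σ) (hc : BalancedColoring A a c)
    (ha : 3 ≤ a) (hs : StrongConn A) (hdeg : ∀ u, a ≤ deg A u) (hP : ColorDegreeSum A a c)
    (v : V) : σ (σ v) ≠ v := by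
  intro hwv
  have hne : v ≠ σ v := by
    intro h
    have := hc.arc _ _ (hσ.arc v)
    rw [← h] at this
    simp at this
  have hO : ∀ z, σ z ∈ ({v, σ v} : Finset V) ↔ z ∈ ({v, σ v} : Finset V) := by
    intro z
    have e1 : σ z = v ↔ z = σ v := by rw [← σ.injective.eq_iff (a := z), hwv]
    have e2 : σ z = σ v ↔ z = v := σ.injective.eq_iff
    simp only [mem_insert, mem_singleton, e1, e2, or_comm]
  have h1 := hσ.outDeg_add_inDeg_le hc hO (v := v) (by simp)
  have h2 := hσ.outDeg_add_inDeg_le hc hO (v := σ v) (by simp)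
  have h3 := card_filter_color_of_invariant hc hσ.arc hO (c v)
  have h4 := card_filter_color_of_invariant hc hσ.arc hO (c (σ v))
  rw [card_pair hne] at h3 h4
  rw [hwv] at h2
  have hsum : deg A v + deg A (σ v) ≤ 2 * a + 2 := by
    unfold deg
    omega
  by_cases hv : deg A v ≤ a + 1
  · exact hσ.not_two_cycle_of_deg_le hc ha hs hdeg hP rfl hwv hsum hv
  · exact hσ.not_two_cycle_of_deg_le hc ha hs hdeg hP hwv rfl (by omega) (by omega)

end TwoCycles

section HamiltonianCycle

variable {V : Type*} [Fintype V] [DecidableEq V] {A : V → V → Prop} [DecidableRel A] {a : ℕ}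
  {c : V → Bool} {σ : Equiv.Perm V}

theorem MaxFactor.sameCycle_of_colorDegreeSum (hσ : MaxFactor A σ) (hc : BalancedColoring A a c)
    (ha : 3 ≤ a) (hs : StrongConn A) (hdeg : ∀ u, a ≤ deg A u) (hP : ColorDegreeSum A a c)
    (u v : V) : σ.SameCycle u v := by
  classical
  by_contra huv
  have h2 := hσ.not_two_cycle hc ha hs hdeg hP
  set O := univ.filter fun z => σ.SameCycle u z
  have hO : ∀ z, σ z ∈ O ↔ z ∈ O := fun z => by simp [O]
  have hO' : ∀ z, σ z ∈ Oᶜ ↔ z ∈ Oᶜ := fun z => by rw [mem_compl, mem_compl, hO]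
  have hne : O.Nonempty := ⟨u, by simp [O, Equiv.Perm.SameCycle.refl]⟩
  have hne' : Oᶜ.Nonempty := ⟨v, by simpa [O] using huv⟩
  have hsum := card_add_card_compl O
  rw [hc.card_univ] at hsum
  have hcard : O.card = a := by
    rcases le_total O.card a with h | h
    · exact (hσ.eq_of_card_le hc hP h2 hO hne h).1
    · have := (hσ.eq_of_card_le hc hP h2 hO' hne' (by omega)).1
      omega
  exact hσ.not_two_halves hc (by omega) hs hP h2 hO hcard (by omega)

/-- A same-coloured pair violating the degree sum forces all other vertices of that colour
to be joined in both directions to the whole opposite class. -/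
theorem arcs_of_deg_lt (hc : BalancedColoring A a c) (hd : DegreeSum A a)
    (hdeg : ∀ u, a ≤ deg A u) (hout : ∀ v, ∃ w, A v w) {u v : V} (huv : u ≠ v)
    (hcuv : c u = c v) (hlt : deg A u + deg A v < 3 * a) :
    ∀ w, w ≠ u → w ≠ v → c w = c u → ∀ z, c z = !c u → A w z ∧ A z w := by
  have hno : ¬ ShareNeighbor A u v := fun h => by
    have := hd u v huv h
    omega
  have hdisj : Disjoint (univ.filter fun z => A u z) (univ.filter fun z => A v z) := by
    rw [disjoint_left]
    intro z hz hz'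
    exact hno (Or.inr ⟨z, by simpa using hz, by simpa using hz'⟩)
  have hcol : ∀ z ∈ (univ.filter fun z => A u z) ∪ univ.filter fun z => A v z, c z = !c u := by
    intro z hz
    simp only [mem_union, mem_filter, mem_univ, true_and] at hz
    rcases hz with h | h
    · exact hc.arc _ _ h
    · rw [hcuv]
      exact hc.arc _ _ h
  have hle : outDeg A u + outDeg A v ≤ a := by
    rw [outDeg, outDeg, ← card_union_of_disjoint hdisj]
    exact hc.card_le hcol
  have hin : inDeg A u + inDeg A v ≤ a := by
    rw [inDeg, inDeg, ← card_union_of_disjoint]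
    · refine hc.card_le (b := !c u) fun z hz => ?_
      simp only [mem_union, mem_filter, mem_univ, true_and] at hz
      rcases hz with h | h
      · exact hc.arc' h
      · rw [hcuv]
        exact hc.arc' h
    · rw [disjoint_left]
      intro z hz hz'
      exact hno (Or.inl ⟨z, by simpa using hz, by simpa using hz'⟩)
  have hu := hdeg u
  have hv := hdeg v
  have hcover : ∀ z, c z = !c u → A u z ∨ A v z := by
    intro z hz
    by_contra h
    have : outDeg A u + outDeg A v < a := by
      rw [outDeg, outDeg, ← card_union_of_disjoint hdisj]
      exact hc.card_lt hcol hz (by simpa using h)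
    unfold deg at *
    omega
  intro w hwu hwv hwc
  have hw : 2 * a ≤ deg A w := by
    obtain ⟨z, hz⟩ := hout w
    rcases hcover z (by rw [hc.arc _ _ hz, hwc]) with h | h
    · have := hd w u hwu (Or.inr ⟨z, hz, h⟩)
      unfold deg at *
      omega
    · have := hd w v hwv (Or.inr ⟨z, hz, h⟩)
      unfold deg at *
      omega
  have h1 := hc.outDeg_le w
  have h2 := hc.inDeg_le w
  intro z hz
  rw [← hwc] at hz
  constructor
  · by_contra h
    have := hc.outDeg_lt hz h
    unfold deg at *
    omega
  · by_contra h
    have := hc.inDeg_lt hz h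
    unfold deg at *
    omega

theorem MaxFactor.sameCycle_of_full (hσ : MaxFactor A σ) (hc : BalancedColoring A a c)
    (ha : 3 ≤ a) (hdeg : ∀ u, a ≤ deg A u) {u v : V}
    (hno : ¬ ShareNeighbor A u v)
    (hfull : ∀ w, w ≠ u → w ≠ v → c w = c u → ∀ z, c z = !c u → A w z ∧ A z w)
    {w : V} (hwu : w ≠ u) (hwv : w ≠ v) (hwc : c w = c u) : σ.SameCycle w u := by
  have hσc : ∀ z, c (σ z) = !c z := fun z => hc.arc _ _ (hσ.arc z)
  have hsym : ∀ w, c (σ.symm w) = !c w := fun w => by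
    rw [hc.arc' (hσ.arc (σ.symm w)), σ.apply_symm_apply]
  by_contra hwu'
  have hns : ∀ w', w' ≠ u → w' ≠ v → c w' = c u → ¬ σ.SameCycle w' u := by
    intro w' h1 h2 h3 h4
    refine hσ.not_merge (x := w) (y := w') (fun h => hwu' (h.trans h4)) ⟨?_, ?_⟩
    · exact (hfull w hwu hwv hwc _ (by rw [hσc, h3])).1
    · exact (hfull w' h1 h2 h3 _ (by rw [hσc, hwc])).1
  have hout : ∀ z, A u z → z = σ u := by
    intro z hz
    have hcz := hc.arc _ _ hz
    by_contra hne
    have hne' : σ.symm z ≠ u := fun h => hne (by rw [← h, σ.apply_symm_apply])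
    by_cases hv : σ.symm z = v
    · exact hno (Or.inr ⟨z, hz, by rw [← σ.apply_symm_apply z, hv]; exact hσ.arc v⟩)
    · have hc' : c (σ.symm z) = c u := by rw [hsym, hcz, Bool.not_not]
      exact hσ.not_merge (hns _ hne' hv hc')
        ⟨(hfull _ hne' hv hc' _ (hσc u)).1, by rwa [σ.apply_symm_apply]⟩
  have hin : ∀ z, A z u → z = σ.symm u := by
    intro z hz
    have hcz := hc.arc' hz
    by_contra hne
    have hne' : σ z ≠ u := fun h => hne (by rw [← h, σ.symm_apply_apply])
    by_cases hv : σ z = v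
    · exact hno (Or.inl ⟨z, hz, hv ▸ hσ.arc z⟩)
    · have hc' : c (σ z) = c u := by rw [hσc, hcz, Bool.not_not]
      refine hσ.not_merge (x := z) (y := σ.symm u) (fun h => hns _ hne' hv hc' ?_)
        ⟨by rwa [σ.apply_symm_apply], (hfull _ hne' hv hc' _ (hsym u)).2⟩
      have := Equiv.Perm.sameCycle_apply_left.2 (Equiv.Perm.sameCycle_apply_right.2 h)
      rwa [σ.apply_symm_apply] at this
  have := outDeg_le_one (A := A) fun p q hp hq => (hout p hp).trans (hout q hq).symm
  have := inDeg_le_one (A := A) fun p q hp hq => (hin p hp).trans (hin q hq).symm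
  have := hdeg u
  unfold deg at *
  omega

theorem MaxFactor.sameCycle_of_deg_lt (hσ : MaxFactor A σ) (hc : BalancedColoring A a c)
    (ha : 3 ≤ a) (hd : DegreeSum A a) (hdeg : ∀ u, a ≤ deg A u) {u v : V} (huv : u ≠ v)
    (hcuv : c u = c v) (hlt : deg A u + deg A v < 3 * a) (p q : V) : σ.SameCycle p q := by
  have hno : ¬ ShareNeighbor A u v := fun h => by
    have := hd u v huv h
    omega
  have hno' : ¬ ShareNeighbor A v u := by
    rintro (⟨z, h, h'⟩ | ⟨z, h, h'⟩)
    exacts [hno (Or.inl ⟨z, h', h⟩), hno (Or.inr ⟨z, h', h⟩)]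
  have hfull := arcs_of_deg_lt hc hd hdeg (fun v => ⟨_, hσ.arc v⟩) huv hcuv hlt
  obtain ⟨w, hwu, hwv, hwc⟩ := hc.exists_ne_ne ha u v
  have hσc : ∀ z, c (σ z) = !c z := fun z => hc.arc _ _ (hσ.arc z)
  have hu := hσ.sameCycle_of_full hc ha hdeg hno hfull hwu hwv hwc
  have hv := hσ.sameCycle_of_full hc ha hdeg hno'
    (fun w h1 h2 h3 z hz => hfull w h2 h1 (h3.trans hcuv.symm) z (by rw [hz, hcuv])) hwv hwu
    (hwc.trans hcuv)
  have hcol : ∀ z, c z = c u → σ.SameCycle w z := by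
    intro z hz
    by_cases hzu : z = u
    · rwa [hzu]
    by_cases hzv : z = v
    · rwa [hzv]
    by_contra h
    refine hσ.not_merge h ⟨?_, ?_⟩
    · exact (hfull w hwu hwv hwc _ (by rw [hσc, hz])).1
    · exact (hfull z hzu hzv hz _ (by rw [hσc, hwc])).1
  have hall : ∀ z, σ.SameCycle w z := by
    intro z
    by_cases hz : c z = c u
    · exact hcol z hz
    · refine Equiv.Perm.sameCycle_apply_right.1 (hcol (σ z) ?_)
      rw [hσc]
      revert hz
      cases c z <;> cases c u <;> simp
  exact (hall p).symm.trans (hall q)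

theorem exists_hamiltonian (hc : BalancedColoring A a c) (ha : 3 ≤ a) (hd : DegreeSum A a)
    (hs : StrongConn A) (hdeg : ∀ u, a ≤ deg A u) :
    ∃ σ : Equiv.Perm V, (∀ v, A v (σ v)) ∧ ∀ u v, σ.SameCycle u v := by
  have hout : ∀ v, ∃ w, A v w := fun v => by
    obtain ⟨w, hw, -⟩ := hc.exists_ne (by omega) v
    exact exists_out hs hw.symm
  have hin : ∀ v, ∃ w, A w v := fun v => by
    obtain ⟨w, hw, -⟩ := hc.exists_ne (by omega) v
    exact exists_in hs hw
  obtain ⟨σ, hσ⟩ := exists_maxFactor (exists_factor hc hd hout hin)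
  refine ⟨σ, hσ.arc, ?_⟩
  by_cases hP : ColorDegreeSum A a c
  · exact hσ.sameCycle_of_colorDegreeSum hc ha hs hdeg hP
  · unfold ColorDegreeSum at hP
    push Not at hP
    obtain ⟨u, v, huv, hcuv, hlt⟩ := hP
    exact hσ.sameCycle_of_deg_lt hc ha hd hdeg huv hcuv hlt

end HamiltonianCycle

section CycleCounting

variable {V : Type*} [Fintype V] {A : V → V → Prop} {a : ℕ} {c : V → Bool}

theorem card_filter_le_of_cover {ι κ : Type*} [Fintype ι] {p : V → Prop} [DecidablePred p]
    (f : ι → V) (g : κ → V) (J : Finset κ)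
    (h : ∀ v, p v → (∃ i, f i = v) ∨ ∃ j ∈ J, g j = v) :
    (univ.filter p).card ≤ (univ.filter fun i => p (f i)).card + J.card := by
  classical
  have hsub : univ.filter p ⊆ ((univ.filter fun i => p (f i)).image f) ∪ J.image g := by
    intro v hv
    have hv : p v := by simpa using hv
    rw [mem_union, mem_image, mem_image]
    rcases h v hv with ⟨i, rfl⟩ | h
    · exact Or.inl ⟨i, by simpa using hv, rfl⟩
    · exact Or.inr h
  exact (card_le_card hsub).trans ((card_union_le _ _).trans
    (add_le_add card_image_le card_image_le))

variable {m : ℕ} [NeZero (2 * m)] {f : ZMod (2 * m) → V}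

theorem card_filter_add_right {n : ℕ} [NeZero n] (p : ZMod n → Prop) [DecidablePred p]
    (t : ZMod n) :
    (univ.filter fun i => p (i + t)).card = (univ.filter p).card :=
  Finset.card_equiv (Equiv.addRight t) fun i => by simp

theorem card_cycle_color (hc : BalancedColoring A a c) (hA : ∀ i, A (f i) (f (i + 1)))
    (b : Bool) : (univ.filter fun i => c (f i) = b).card = m := by
  have h1 := card_filter_add_right (fun i => c (f i) = b) 1
  have h2 := card_filter_add_card_filter_not (s := univ) (fun i => c (f i) = b)
  have h3 : (univ.filter fun i => c (f (i + 1)) = b) = univ.filter fun i => ¬ c (f i) = b := by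
    ext i
    have := hc.arc _ _ (hA i)
    rw [mem_filter, mem_filter, this]
    cases c (f i) <;> cases b <;> simp
  rw [h3] at h1
  rw [Finset.card_univ, ZMod.card] at h2
  omega

theorem color_cycle_add_even (hc : BalancedColoring A a c) {n : ℕ} {f : ZMod n → V}
    (hA : ∀ i, A (f i) (f (i + 1))) (i : ZMod n) (k : ℕ) :
    c (f (i + (2 * k : ℕ))) = c (f i) := by
  induction k with
  | zero => simp
  | succ k ih =>
    have : i + (2 * (k + 1) : ℕ) = i + (2 * k : ℕ) + 1 + 1 := by
      push_cast
      ring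
    rw [this, hc.arc _ _ (hA _), hc.arc _ _ (hA _), ih, Bool.not_not]

variable [DecidableRel A]

theorem card_cycle_out_le (hc : BalancedColoring A a c) (hA : ∀ i, A (f i) (f (i + 1)))
    (x : V) : (univ.filter fun i => A x (f i)).card ≤ m := by
  refine le_of_le_of_eq ?_ (card_cycle_color hc hA (!c x))
  exact card_le_card fun i hi => by
    simpa using hc.arc _ _ (show A x (f i) by simpa using hi)

theorem card_cycle_in_le (hc : BalancedColoring A a c) (hA : ∀ i, A (f i) (f (i + 1)))
    (x : V) : (univ.filter fun i => A (f i) x).card ≤ m := by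
  refine le_of_le_of_eq ?_ (card_cycle_color hc hA (!c x))
  exact card_le_card fun i hi => by
    simpa using hc.arc' (show A (f i) x by simpa using hi)

/-- If a path from `p` to `q` cannot be inserted into a cycle, the number of attachments
of its ends is bounded by half of the length of the cycle. -/
theorem card_cycle_in_add_out_le (hc : BalancedColoring A a c) (hA : ∀ i, A (f i) (f (i + 1)))
    {p q : V} (hpq : c q = !c p) (h : ∀ t, ¬ (A (f t) p ∧ A q (f (t + 1)))) :
    (univ.filter fun i => A (f i) p).card + (univ.filter fun i => A q (f i)).card ≤ m := by
  refine le_of_le_of_eq ?_ (card_cycle_color hc hA (!c p))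
  rw [← card_filter_add_right (fun i => A q (f i)) 1, ← card_union_of_disjoint]
  · refine card_le_card fun i hi => ?_
    simp only [mem_union, mem_filter, mem_univ, true_and] at hi ⊢
    rcases hi with hi | hi
    · exact hc.arc' hi
    · rw [hc.arc' (hA i), hc.arc _ _ hi, hpq, Bool.not_not]
  · rw [disjoint_left]
    intro i hi hi'
    exact h i ⟨by simpa using hi, by simpa using hi'⟩

/-- If all degrees are large, a cycle missing only two vertices yields cycles of all even
lengths up to its own. -/
theorem hasCycle_of_hasCycle_pred (hc : BalancedColoring A a c) (hdeg : ∀ u, a + 2 ≤ deg A u)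
    (hcyc : HasCycle A (2 * (a - 1))) {k : ℕ} (hk : 1 ≤ k) (hka : k < a) :
    HasCycle A (2 * k) := by
  classical
  obtain ⟨h2, f, hf, hA⟩ := hcyc
  have : NeZero (2 * (a - 1)) := ⟨by omega⟩
  obtain ⟨x, hx⟩ : ∃ x, ∀ i, f i ≠ x := by
    by_contra! h
    have hle := Fintype.card_le_of_surjective f h
    rw [ZMod.card, hc.card_univ] at hle
    omega
  set J := (univ.filter fun v => c v = !c x) \ (univ.filter fun i => c (f i) = !c x).image f
    with hJ
  have hJcard : J.card = 1 := by
    have : J.card + ((univ.filter fun i => c (f i) = !c x).image f).card =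
        (univ.filter fun v => c v = !c x).card :=
      card_sdiff_add_card_eq_card fun v hv => by
        obtain ⟨i, hi, rfl⟩ := mem_image.1 hv
        simpa using hi
    rw [hc.card, card_image_of_injective _ hf, card_cycle_color hc hA] at this
    omega
  have hcover : ∀ v, c v = (!c x) → (∃ i, f i = v) ∨ ∃ j ∈ J, id j = v := by
    intro v hv
    by_cases h : ∃ i, f i = v
    · exact Or.inl h
    · refine Or.inr ⟨v, ?_, rfl⟩
      rw [hJ, mem_sdiff, mem_image]
      exact ⟨by simpa using hv, fun ⟨i, _, hi⟩ => h ⟨i, hi⟩⟩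
  have hout : outDeg A x ≤ _ := card_filter_le_of_cover f id J fun v hv => hcover v (hc.arc _ _ hv)
  have hin : inDeg A x ≤ _ := card_filter_le_of_cover f id J fun v hv => hcover v (hc.arc' hv)
  obtain ⟨k, rfl⟩ : ∃ k', k = k' + 1 := ⟨k - 1, by omega⟩
  rw [← card_filter_add_right (fun i => A (f i) x) ((2 * k : ℕ) : ZMod (2 * (a - 1)))] at hin
  obtain ⟨i, hi⟩ : ((univ.filter fun i => A x (f i)) ∩
      univ.filter fun i => A (f (i + (2 * k : ℕ))) x).Nonempty := by
    rw [← card_pos]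
    have hU := card_union_add_card_inter (univ.filter fun i => A x (f i))
      (univ.filter fun i => A (f (i + (2 * k : ℕ))) x)
    have hle : ((univ.filter fun i => A x (f i)) ∪
        univ.filter fun i => A (f (i + (2 * k : ℕ))) x).card ≤ a - 1 := by
      refine le_of_le_of_eq ?_ (card_cycle_color hc hA (!c x))
      refine card_le_card fun i hi => ?_
      simp only [mem_union, mem_filter, mem_univ, true_and] at hi ⊢
      rcases hi with hi | hi
      · exact hc.arc _ _ hi
      · rw [← color_cycle_add_even hc hA i k]
        exact hc.arc' hi
    have := hdeg x
    unfold deg at this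
    omega
  simp only [mem_inter, mem_filter, mem_univ, true_and] at hi
  let g : ℕ → V := fun j => if j = 0 then x else f (i + (j - 1 : ℕ))
  have g0 : g 0 = x := rfl
  have gs : ∀ j, g (j + 1) = f (i + j) := fun j => by simp [g]
  have hg : CycleSeq A (2 * (k + 1)) g := by
    refine ⟨?_, ?_, ?_⟩
    · intro j hj j' hj' h
      rcases j with _ | j <;> rcases j' with _ | j'
      · rfl
      · rw [g0, gs] at h
        exact absurd h.symm (hx _)
      · rw [g0, gs] at h
        exact absurd h (hx _)
      · rw [gs, gs] at h
        rw [zmod_natCast_inj (by omega) (by omega) (add_left_cancel (hf h))]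
    · intro j hj
      rcases j with _ | j
      · rw [g0, gs]
        simpa using hi.1
      · rw [gs, gs]
        push_cast
        rw [← add_assoc]
        exact hA _
    · rw [g0, show 2 * (k + 1) - 1 = 2 * k + 1 by omega, gs]
      exact hi.2
  exact hg.hasCycle (by omega)

end CycleCounting

section Chords

variable {V : Type*} [Fintype V] {A : V → V → Prop} {a : ℕ} {c : V → Bool} {σ : Equiv.Perm V}

theorem color_pow_apply (hc : BalancedColoring A a c) (hA : ∀ v, A v (σ v)) (v : V) (i : ℕ) :
    c ((σ ^ i) v) = if i % 2 = 0 then c v else !c v := by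
  induction i with
  | zero => simp
  | succ n ih =>
    rw [pow_succ_apply, hc.arc _ _ (hA _), ih]
    split_ifs <;> first | omega | simp

theorem mod_two_ne_of_arc (hc : BalancedColoring A a c) (hA : ∀ v, A v (σ v)) {p : V} {i j : ℕ}
    (h : A ((σ ^ i) p) ((σ ^ j) p)) : i % 2 ≠ j % 2 := by
  intro hij
  have := hc.arc _ _ h
  rw [color_pow_apply hc hA, color_pow_apply hc hA, hij] at this
  simp at this

theorem hasCycle_of_two_mul_le_deg [DecidableRel A] (hc : BalancedColoring A a c)
    (hσ : ∀ u v, σ.SameCycle u v) (hA : ∀ v, A v (σ v))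
    {x : V} (hx : 2 * a ≤ deg A x + 1) {k : ℕ} (hk : 1 ≤ k) (hka : k ≤ a) :
    HasCycle A (2 * k) := by
  have hcard := hc.card_univ
  by_cases h1 : A ((σ ^ (2 * k - 1)) x) x
  · exact (cycleSeq_pow hσ hA x (by omega) h1).hasCycle (by omega)
  by_cases h2 : A x ((σ ^ (2 * a - 2 * k + 1)) x)
  · refine (cycleSeq_pow hσ hA ((σ ^ (2 * a - 2 * k + 1)) x) (n := 2 * k) (by omega) ?_).hasCycle
      (by omega)
    rw [← Equiv.Perm.mul_apply, ← pow_add,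
      show 2 * k - 1 + (2 * a - 2 * k + 1) = Fintype.card V by omega, pow_card_apply hσ]
    exact h2
  exfalso
  have := hc.inDeg_lt (by rw [color_pow_apply hc hA, if_neg (by omega)]) h1
  have := hc.outDeg_lt (by rw [color_pow_apply hc hA, if_neg (by omega)]) h2
  unfold deg at hx
  omega

end Chords

section Skips

variable {V : Type*} [Fintype V] {A : V → V → Prop} {a : ℕ} {c : V → Bool} {σ : Equiv.Perm V}

/-- There is a cycle avoiding a segment of `2 * r` consecutive vertices of the Hamiltonian
cycle `σ` and passing through all other vertices. -/
def HasSegmentCycle (A : V → V → Prop) (σ : Equiv.Perm V) (a r : ℕ) : Prop :=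
  ∃ p, HasCycleAvoiding A (2 * (a - r)) fun v => ∃ j < 2 * r, (σ ^ j) p = v

theorem hasSegmentCycle_of_skip (hc : BalancedColoring A a c) (hσ : ∀ u v, σ.SameCycle u v)
    (hA : ∀ v, A v (σ v)) {s : ℕ} (hsa : s < a) {v : V} (hv : A v ((σ ^ (2 * s + 1)) v)) :
    HasSegmentCycle A σ a s := by
  have hcard := hc.card_univ
  set u := (σ ^ (2 * s)) (σ v) with hu
  have hu' : u = (σ ^ (2 * s + 1)) v := by rw [hu, pow_succ, Equiv.Perm.mul_apply]
  obtain ⟨f, hf, hfA, hr⟩ := (cycleSeq_pow hσ hA u (n := 2 * (a - s)) (by omega) (by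
    rw [hu', ← Equiv.Perm.mul_apply, ← pow_add,
      show 2 * (a - s) - 1 + (2 * s + 1) = Fintype.card V by omega, pow_card_apply hσ]
    exact hv)).exists_zmod (by omega)
  refine ⟨σ v, f, hf, hfA, ?_⟩
  rintro i ⟨j, hj, hij⟩
  obtain ⟨t, ht, hti⟩ := (hr (f i)).1 ⟨i, rfl⟩
  rw [← hij, hu, ← Equiv.Perm.mul_apply, ← pow_add] at hti
  have := pow_apply_inj hσ (σ v) (by omega) (by omega) hti
  omega

/-- A subsegment which attaches to an arc of a cycle avoiding the segment can be inserted. -/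
theorem hasCycleAvoiding_insert_pow (hc : BalancedColoring A a c)
    (hσ : ∀ u v, σ.SameCycle u v) (hA : ∀ v, A v (σ v)) {r : ℕ} (hr : r < a) {p : V}
    {f : ZMod (2 * (a - r)) → V} (hf : Function.Injective f) (hfA : ∀ i, A (f i) (f (i + 1)))
    (hfp : ∀ i, ¬ ∃ j < 2 * r, (σ ^ j) p = f i) {b l : ℕ} (hl : 0 < l) (hbl : b + l ≤ 2 * r)
    {P : V → Prop} (hP : ∀ v, P v → ∃ j < 2 * r, (j < b ∨ b + l ≤ j) ∧ (σ ^ j) p = v)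
    {t : ZMod (2 * (a - r))}
    (ht : A (f t) ((σ ^ b) p) ∧ A ((σ ^ (b + l - 1)) p) (f (t + 1))) :
    HasCycleAvoiding A (2 * (a - r) + l) P := by
  have hcard := hc.card_univ
  refine hasCycleAvoiding_insert (q := fun j => (σ ^ (b + j)) p) (by omega) hl hf hfA ?_ ?_ ?_ ?_
    ?_ (t := t) ?_
  · intro i hi j hj h
    have := pow_apply_inj hσ p (by omega) (by omega) h
    omega
  · intro i _
    simp only [← add_assoc, pow_succ_apply]
    exact hA _
  · intro i j hj h
    exact hfp i ⟨b + j, by omega, h.symm⟩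
  · intro i hi
    obtain ⟨j, hj, -, h⟩ := hP _ hi
    exact hfp i ⟨j, hj, h⟩
  · intro j hj hq
    obtain ⟨j', hj', hor, h⟩ := hP _ hq
    have := pow_apply_inj hσ p (by omega) (by omega) h
    omega
  · simpa [Nat.add_sub_assoc (show 1 ≤ l by omega)] using ht

theorem cover_of_segment (hc : BalancedColoring A a c) (hσ : ∀ u v, σ.SameCycle u v) {r : ℕ}
    (hr : r < a) {p : V} {f : ZMod (2 * (a - r)) → V} (hf : Function.Injective f)
    (hfp : ∀ i, ¬ ∃ j < 2 * r, (σ ^ j) p = f i) (v : V) :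
    (∃ i, f i = v) ∨ ∃ j < 2 * r, (σ ^ j) p = v := by
  classical
  have hcard := hc.card_univ
  have : NeZero (2 * (a - r)) := ⟨by omega⟩
  have hU : (univ.image f) ∪ ((range (2 * r)).image fun j => (σ ^ j) p) = univ := by
    rw [← card_eq_iff_eq_univ, card_union_of_disjoint, card_image_of_injective _ hf,
      card_image_of_injOn, Finset.card_univ, ZMod.card, card_range]
    · omega
    · intro i hi j hj h
      simp only [coe_range, Set.mem_Iio] at hi hj
      exact pow_apply_inj hσ p (by omega) (by omega) h
    · rw [disjoint_left]
      intro v hv hv'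
      obtain ⟨i, -, rfl⟩ := mem_image.1 hv
      obtain ⟨j, hj, h⟩ := mem_image.1 hv'
      exact hfp i ⟨j, by simpa using hj, h⟩
  have hv := mem_univ v
  rw [← hU, mem_union, mem_image, mem_image] at hv
  rcases hv with ⟨i, -, h⟩ | ⟨j, hj, h⟩
  · exact Or.inl ⟨i, h⟩
  · exact Or.inr ⟨j, by simpa using hj, h⟩

/-- On eight vertices, chords of length five and seven produce a cycle of length six. -/
theorem hasCycle_six (hσ : ∀ u v, σ.SameCycle u v) (hA : ∀ v, A v (σ v))
    (hcard : Fintype.card V = 8) (h5 : ∀ v, A v ((σ ^ 5) v)) (h7 : ∀ v, A v ((σ ^ 7) v)) :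
    HasCycle A 6 := by
  obtain ⟨v⟩ : Nonempty V := Fintype.card_pos_iff.1 (by omega)
  have step : ∀ i j, (i + 1) % 8 = j % 8 ∨ (i + 5) % 8 = j % 8 ∨ (i + 7) % 8 = j % 8 →
      A ((σ ^ i) v) ((σ ^ j) v) := by
    intro i j hij
    have key : ∀ k, (∀ v, A v ((σ ^ k) v)) → (i + k) % 8 = j % 8 →
        A ((σ ^ i) v) ((σ ^ j) v) := by
      intro k hk hikj
      have : (σ ^ j) v = (σ ^ k) ((σ ^ i) v) := by
        rw [← Equiv.Perm.mul_apply, ← pow_add, pow_apply_eq_iff hσ, hcard, add_comm]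
        exact hikj.symm
      rw [this]
      exact hk _
    rcases hij with h | h | h
    exacts [key 1 (by simpa using hA) h, key 5 h5 h, key 7 h7 h]
  let e : ℕ → ℕ := fun i => [0, 5, 6, 7, 4, 3].getD i 0
  refine CycleSeq.hasCycle (g := fun i => (σ ^ e i) v) ⟨?_, ?_, ?_⟩ (by norm_num)
  · have hlt : ∀ i < 6, e i < 8 := by decide
    have hinj : ∀ i < 6, ∀ j < 6, e i = e j → i = j := by decide
    intro i hi j hj h
    exact hinj i hi j hj (pow_apply_inj hσ v (by rw [hcard]; exact hlt i hi)
      (by rw [hcard]; exact hlt j hj) h)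
  · have harc : ∀ i < 5, (e i + 1) % 8 = e (i + 1) % 8 ∨ (e i + 5) % 8 = e (i + 1) % 8 ∨
        (e i + 7) % 8 = e (i + 1) % 8 := by decide
    exact fun i hi => step _ _ (harc i (by omega))
  · exact step _ _ (by decide)

variable [DecidableRel A]

/-- If no arc skips ahead inside a segment, the segment can be shortened. -/
theorem hasSegmentCycle_shorten (hc : BalancedColoring A a c) (hσ : ∀ u v, σ.SameCycle u v)
    (hA : ∀ v, A v (σ v)) (hP : ColorDegreeSum A a c) (ha : 5 ≤ a) {r : ℕ} (hr : 1 ≤ r)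
    (hra : r + 1 < a) (hskip : ∀ t, 1 ≤ t → t ≤ r → ∀ v, ¬ A v ((σ ^ (2 * t + 1)) v))
    (h : HasSegmentCycle A σ a (r + 1)) :
    HasSegmentCycle A σ a r ∨ HasCycle A (2 * (a - 1)) := by
  have hcard := hc.card_univ
  obtain ⟨p, f, hf, hfA, hfp⟩ := h
  have hNZ : NeZero (2 * (a - (r + 1))) := ⟨by omega⟩
  by_contra! hno
  obtain ⟨hno1, hno2⟩ := hno
  have hcover := cover_of_segment hc hσ (by omega) hf hfp
  have hσc : ∀ z, c (σ z) = !c z := fun z => hc.arc _ _ (hA z)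
  have hlen : 2 * (a - (r + 1)) + 2 = 2 * (a - r) := by omega
  have hprefix : ∀ t, ¬ (A (f t) ((σ ^ 0) p) ∧ A ((σ ^ 1) p) (f (t + 1))) := by
    intro t ht
    refine hno1 ⟨(σ ^ 2) p, ?_⟩
    rw [← hlen]
    refine hasCycleAvoiding_insert_pow hc hσ hA (by omega) hf hfA hfp (b := 0) (l := 2)
      (by omega) (by omega) ?_ ht
    rintro v ⟨j, hj, rfl⟩
    exact ⟨j + 2, by omega, by omega, by rw [pow_add, Equiv.Perm.mul_apply]⟩
  have hsuffix : ∀ t, ¬ (A (f t) ((σ ^ (2 * r)) p) ∧ A ((σ ^ (2 * r + 1)) p) (f (t + 1))) := by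
    intro t ht
    refine hno1 ⟨p, ?_⟩
    rw [← hlen]
    refine hasCycleAvoiding_insert_pow hc hσ hA (by omega) hf hfA hfp (b := 2 * r) (l := 2)
      (by omega) (by omega) ?_ ht
    rintro v ⟨j, hj, rfl⟩
    exact ⟨j, by omega, by omega, rfl⟩
  have hmiddle : ∀ t, ¬ (A (f t) ((σ ^ 1) p) ∧ A ((σ ^ (2 * r)) p) (f (t + 1))) := by
    intro t ht
    refine hno2 (HasCycleAvoiding.hasCycle (P := fun _ => False) ?_ (by omega))
    rw [show 2 * (a - 1) = 2 * (a - (r + 1)) + 2 * r by omega]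
    exact hasCycleAvoiding_insert_pow hc hσ hA (by omega) hf hfA hfp (b := 1) (l := 2 * r)
      (by omega) (by omega) (fun _ h => h.elim) (by rwa [show 1 + 2 * r - 1 = 2 * r by omega])
  have hinner : ∀ i j, i < 2 * (r + 1) → j < 2 * (r + 1) → A ((σ ^ i) p) ((σ ^ j) p) →
      j ≤ i + 1 ∧ i % 2 ≠ j % 2 := by
    intro i j hi hj hij
    have hpar := mod_two_ne_of_arc hc hA hij
    refine ⟨?_, hpar⟩
    by_contra hlt
    refine hskip ((j - i) / 2) (by omega) (by omega) ((σ ^ i) p) ?_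
    rwa [← Equiv.Perm.mul_apply, ← pow_add, show 2 * ((j - i) / 2) + 1 + i = j by omega]
  have hout : ∀ i < 2 * (r + 1), ∀ J : Finset ℕ,
      (∀ j < 2 * (r + 1), j ≤ i + 1 → i % 2 ≠ j % 2 → j ∈ J) →
      outDeg A ((σ ^ i) p) ≤ (univ.filter fun t => A ((σ ^ i) p) (f t)).card + J.card := by
    intro i hi J hJ
    refine card_filter_le_of_cover f (fun j => (σ ^ j) p) J fun v hv => ?_
    refine (hcover v).imp_right ?_
    rintro ⟨j, hj, rfl⟩
    have := hinner i j hi hj hv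
    exact ⟨j, hJ j hj this.1 this.2, rfl⟩
  have hin : ∀ i < 2 * (r + 1), ∀ J : Finset ℕ,
      (∀ j < 2 * (r + 1), i ≤ j + 1 → i % 2 ≠ j % 2 → j ∈ J) →
      inDeg A ((σ ^ i) p) ≤ (univ.filter fun t => A (f t) ((σ ^ i) p)).card + J.card := by
    intro i hi J hJ
    refine card_filter_le_of_cover f (fun j => (σ ^ j) p) J fun v hv => ?_
    refine (hcover v).imp_right ?_
    rintro ⟨j, hj, rfl⟩
    have := hinner j i hj hi hv
    exact ⟨j, hJ j hj this.1 this.2.symm, rfl⟩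
  set odds := (range (r + 1)).image fun j => 2 * j + 1
  set evens := (range (r + 1)).image fun j => 2 * j
  have hodds : odds.card ≤ r + 1 := card_image_le.trans (card_range _).le
  have hevens : evens.card ≤ r + 1 := card_image_le.trans (card_range _).le
  have memo : ∀ j < 2 * (r + 1), j % 2 = 1 → j ∈ odds := fun j hj h =>
    mem_image.2 ⟨j / 2, by rw [mem_range]; omega, by omega⟩
  have meme : ∀ j < 2 * (r + 1), j % 2 = 0 → j ∈ evens := fun j hj h =>
    mem_image.2 ⟨j / 2, by rw [mem_range]; omega, by omega⟩
  have o1 := hout 0 (by omega) {1} fun j _ _ _ => by rw [mem_singleton]; omega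
  have o2 := hout 1 (by omega) {0, 2} fun j _ _ _ => by
    rw [mem_insert, mem_singleton]; omega
  have o3 := hout (2 * r) (by omega) odds fun j hj _ _ => memo j hj (by omega)
  have o4 := hout (2 * r + 1) (by omega) evens fun j hj _ _ => meme j hj (by omega)
  have i1 := hin 0 (by omega) odds fun j hj _ _ => memo j hj (by omega)
  have i2 := hin 1 (by omega) evens fun j hj _ _ => meme j hj (by omega)
  have i3 := hin (2 * r) (by omega) {2 * r - 1, 2 * r + 1} fun j _ _ _ => by
    rw [mem_insert, mem_singleton]; omega
  have i4 := hin (2 * r + 1) (by omega) {2 * r} fun j _ _ _ => by rw [mem_singleton]; omega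
  have c2 : ({0, 2} : Finset ℕ).card ≤ 2 := card_le_two
  have c3 : ({2 * r - 1, 2 * r + 1} : Finset ℕ).card ≤ 2 := card_le_two
  rw [card_singleton] at o1 i4
  have m1 := card_cycle_in_add_out_le hc hfA
    (by rw [color_pow_apply hc hA, color_pow_apply hc hA]; simp) hprefix
  have m2 := card_cycle_in_add_out_le hc hfA
    (by rw [color_pow_apply hc hA, color_pow_apply hc hA, if_neg (by omega), if_pos (by omega)])
    hsuffix
  have m3 := card_cycle_in_add_out_le hc hfA
    (by rw [color_pow_apply hc hA, color_pow_apply hc hA, if_pos (by omega), if_neg (by omega),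
      Bool.not_not]) hmiddle
  have m4 := card_cycle_out_le hc hfA ((σ ^ 0) p)
  have m5 := card_cycle_in_le hc hfA ((σ ^ (2 * r + 1)) p)
  have d1 := hP ((σ ^ 0) p) ((σ ^ (2 * r)) p)
    (fun h => by have := pow_apply_inj hσ p (by omega) (by omega) h; omega)
    (by rw [color_pow_apply hc hA, color_pow_apply hc hA, if_pos (by omega), if_pos (by omega)])
  have d2 := hP ((σ ^ 1) p) ((σ ^ (2 * r + 1)) p)
    (fun h => by have := pow_apply_inj hσ p (by omega) (by omega) h; omega)
    (by rw [color_pow_apply hc hA, color_pow_apply hc hA, if_neg (by omega), if_neg (by omega)])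
  unfold deg at d1 d2
  omega

theorem hasCycle_pred_of_hasSegmentCycle (hc : BalancedColoring A a c)
    (hσ : ∀ u v, σ.SameCycle u v) (hA : ∀ v, A v (σ v)) (hP : ColorDegreeSum A a c)
    (ha : 5 ≤ a) {r : ℕ} (hra : r + 1 < a)
    (hskip : ∀ t, 1 ≤ t → t ≤ r → ∀ v, ¬ A v ((σ ^ (2 * t + 1)) v))
    (h : HasSegmentCycle A σ a (r + 1)) : HasCycle A (2 * (a - 1)) := by
  induction r with
  | zero =>
    obtain ⟨p, h⟩ := h
    exact h.hasCycle (by omega)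
  | succ r ih =>
    rcases hasSegmentCycle_shorten hc hσ hA hP ha (by omega) hra hskip h with h | h
    · exact ih (by omega) (fun t h1 h2 => hskip t h1 (by omega)) h
    · exact h

theorem exists_skip (hc : BalancedColoring A a c) (hσ : ∀ u v, σ.SameCycle u v)
    (hA : ∀ v, A v (σ v)) {u : V} (hu : 3 ≤ deg A u) :
    ∃ s, 1 ≤ s ∧ s < a ∧ ∃ v, A v ((σ ^ (2 * s + 1)) v) := by
  have hcard := hc.card_univ
  obtain ⟨v, w, hvw, hne⟩ : ∃ v w, A v w ∧ w ≠ σ v := by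
    by_contra! h
    have := outDeg_le_one (A := A) fun p q hp hq => (h u p hp).trans (h u q hq).symm
    have := inDeg_le_one (A := A) (u := u) fun p q hp hq =>
      σ.injective ((h p u hp).symm.trans (h q u hq))
    unfold deg at hu
    omega
  obtain ⟨i, hi, rfl⟩ := exists_pow_apply_eq hσ v w
  have hpar := mod_two_ne_of_arc hc hA (p := v) (i := 0) (j := i) hvw
  have hi1 : i ≠ 1 := by
    rintro rfl
    exact hne (by simp)
  refine ⟨i / 2, by omega, by omega, v, ?_⟩
  rwa [show 2 * (i / 2) + 1 = i by omega]

theorem hasCycle_pred (hc : BalancedColoring A a c) (ha : 3 ≤ a)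
    (hσ : ∀ u v, σ.SameCycle u v) (hA : ∀ v, A v (σ v)) (hP : ColorDegreeSum A a c)
    (hdeg : ∀ u, deg A u + 2 ≤ 2 * a) : HasCycle A (2 * (a - 1)) := by
  classical
  have hcard := hc.card_univ
  have hlow : ∀ u, a + 2 ≤ deg A u := by
    intro u
    obtain ⟨v, hv, hvc⟩ := hc.exists_ne (by omega) u
    have := hP v u hv hvc
    have := hdeg v
    omega
  obtain ⟨u⟩ : Nonempty V := Fintype.card_pos_iff.1 (by omega)
  have hex := exists_skip hc hσ hA (u := u) (by have := hlow u; omega)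
  set s := Nat.find hex with hs
  obtain ⟨hs1, hsa, v, hv⟩ := Nat.find_spec hex
  rw [← hs] at hs1 hsa hv
  have hmin : ∀ t, 1 ≤ t → t < s → ∀ v, ¬ A v ((σ ^ (2 * t + 1)) v) := fun t h1 h2 v hv =>
    Nat.find_min hex h2 ⟨h1, by omega, v, hv⟩
  have hseg := hasSegmentCycle_of_skip hc hσ hA hsa hv
  by_cases ha5 : 5 ≤ a
  · refine hasCycle_pred_of_hasSegmentCycle hc hσ hA hP ha5 (r := s - 1) (by omega)
      (fun t h1 h2 => hmin t h1 (by omega)) ?_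
    rwa [Nat.sub_add_cancel hs1]
  by_cases hs2 : s = 1
  · rw [hs2] at hseg
    obtain ⟨p, h⟩ := hseg
    exact h.hasCycle (by omega)
  have hu := hdeg u
  have hu' := hlow u
  obtain rfl : a = 4 := by omega
  have h3 : ∀ v, ¬ A v ((σ ^ 3) v) := hmin 1 le_rfl (by omega)
  have hin : ∀ v, inDeg A v < 4 := by
    intro v
    refine hc.inDeg_lt (v := (σ ^ 5) v) (by rw [color_pow_apply hc hA, if_neg (by omega)]) ?_
    intro h
    apply h3 ((σ ^ 5) v)
    rwa [← Equiv.Perm.mul_apply, ← pow_add, show 3 + 5 = Fintype.card V by omega,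
      pow_card_apply hσ]
  have harc : ∀ k, k % 2 = 1 → k < 8 → k ≠ 3 → ∀ v, A v ((σ ^ k) v) := by
    intro k hk hk8 hk3 v
    by_contra h
    have h1 := hc.outDeg_add_two_le (v := (σ ^ 3) v) (w := (σ ^ k) v)
      (by rw [color_pow_apply hc hA, if_neg (by omega)])
      (by rw [color_pow_apply hc hA, if_neg (by omega)])
      (fun h => hk3 (pow_apply_inj hσ v (by omega) (by omega) h).symm) (h3 v) h
    have h2 := hin v
    have h3 := hlow v
    unfold deg at h3
    omega
  exact hasCycle_six hσ hA hcard (harc 5 rfl (by omega) (by omega))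
    (harc 7 rfl (by omega) (by omega))

end Skips

/-- Adamus: a strongly connected balanced bipartite digraph of
order 2a ≥ 6 that is not a directed cycle, with degree sum ≥ 3a for every pair
of distinct vertices with a common in- or out-neighbor, is even pancyclic. -/
theorem stmt19 {V : Type*} [Fintype V] [DecidableEq V] (A : V → V → Prop) [DecidableRel A]
    (a : ℕ) (ha : 3 ≤ a) (X Y : Finset V)
    (hcard : Fintype.card V = 2 * a) (hX : X.card = a) (hY : Y.card = a)
    (hbip : BipartiteWith A X Y) (hstrong : StrongConn A)
    (hnc : ¬ IsDirectedCycle A)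
    (hdeg : ∀ u v : V, u ≠ v → ((∃ z, A z u ∧ A z v) ∨ (∃ z, A u z ∧ A v z)) →
      3 * a ≤ deg A u + deg A v) :
    ∀ k : ℕ, 1 ≤ k → k ≤ a → HasCycle A (2 * k) := by
  obtain ⟨hXY, hU, harc⟩ := hbip
  have hY' : ∀ v, v ∈ Y ↔ v ∉ X := fun v =>
    ⟨fun h h' => disjoint_left.1 hXY h' h, fun h =>
      (mem_union.1 (hU ▸ mem_univ v)).resolve_left h⟩
  have hc : BalancedColoring A a fun v => decide (v ∈ X) := by
    refine ⟨fun u v huv => ?_, fun b => ?_⟩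
    · rcases harc u v huv with ⟨h, h'⟩ | ⟨h, h'⟩ <;> simp_all
    · cases b
      · rw [← hY]
        congr 1
        ext v
        simp [hY']
      · rw [← hX]
        congr 1
        ext v
        simp
  have hmin := hc.le_deg ha hdeg hstrong hnc
  obtain ⟨σ, hA, hσ⟩ := exists_hamiltonian hc ha hdeg hstrong hmin
  intro k hk hka
  by_cases hbig : ∃ x, 2 * a ≤ deg A x + 1
  · obtain ⟨x, hx⟩ := hbig
    exact hasCycle_of_two_mul_le_deg hc hσ hA hx hk hka
  push Not at hbig
  have hP : ColorDegreeSum A a fun v => decide (v ∈ X) := by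
    intro u v huv hcuv
    by_contra! hlt
    obtain ⟨w, hwu, hwv, hwc⟩ := hc.exists_ne_ne ha u v
    have hfull := arcs_of_deg_lt hc hdeg hmin (fun v => ⟨_, hA v⟩) huv hcuv hlt w hwu hwv hwc
    have h1 := hc.outDeg_add_card w
    have h2 := hc.inDeg_add_card w
    rw [card_eq_zero.2 (filter_eq_empty_iff.2 fun z _ h => h.2 (hfull z (by rw [h.1, hwc])).1)]
      at h1
    rw [card_eq_zero.2 (filter_eq_empty_iff.2 fun z _ h => h.2 (hfull z (by rw [h.1, hwc])).2)]
      at h2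
    have := hbig w
    unfold deg at this
    omega
  rcases hka.eq_or_lt with rfl | hka
  · obtain ⟨v⟩ : Nonempty V := Fintype.card_pos_iff.1 (by omega)
    rw [← hcard]
    exact (cycleSeq_card hσ hA v).hasCycle (by omega)
  · refine hasCycle_of_hasCycle_pred hc (fun u => ?_)
      (hasCycle_pred hc ha hσ hA hP fun u => by have := hbig u; omega) hk hka
    obtain ⟨v, hv, hvc⟩ := hc.exists_ne (by omega) u
    have := hP v u hv hvc
    have := hbig v
    omega
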